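/- arXiv:1909.08559 — 9 statements merged into one kernel-verified Lean document; each statement's English description precedes it below -/
import Mathlib

section
/- Let M = (W,R₁,W×W,V) be a model whose correct relation R₂ is the total relation W×W. For every formula φ of the fragment L_♦⟨+⟩ (built from atoms, ¬, ∧, ♦ and ⟨+⟩ only) and every pointed model (M,S): M,S ⊨ φ if and only if the bridge modal model (W,R₁,V) satisfies φ⋆ at e(S), where φ⋆ is obtained from φ by replacing every occurrence of ♦ with the standard modal diamond ◇ (and ⟨+⟩ is read as the bridge modality). -/
attribute [local instance] Classical.propDecidable

/-- Formulas of the modal logic of supervised learning (SLL), with atoms indexed by ℕ. -/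
inductive Form : Type
  | atom : ℕ → Form
  | neg : Form → Form
  | and : Form → Form → Form
  | dia : Form → Form   -- ♦
  | rem1 : Form → Form  -- ⟨-⟩₁
  | rem2 : Form → Form  -- ⟨-⟩₂
  | add : Form → Form   -- ⟨+⟩

namespace Form

def or (φ ψ : Form) : Form := .neg ((Form.neg φ).and (Form.neg ψ))
def imp (φ ψ : Form) : Form := Form.or (.neg φ) ψ
def bot : Form := (Form.atom 0).and (.neg (.atom 0))
def top : Form := .neg bot
def box (φ : Form) : Form := .neg (.dia (.neg φ))      -- ■
def boxr1 (φ : Form) : Form := .neg (.rem1 (.neg φ))   -- [-]₁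
def boxr2 (φ : Form) : Form := .neg (.rem2 (.neg φ))   -- [-]₂
def boxadd (φ : Form) : Form := .neg (.add (.neg φ))   -- [+]

end Form

/-- A model of SLL. -/
structure SLLModel (W : Type) where
  R1 : Set (W × W)
  R2 : Set (W × W)
  V : ℕ → Set W

namespace SLLModel
variable {W : Type}

/-- M ⊖ e : delete edge `e` from R₁. -/
def del (M : SLLModel W) (e : W × W) : SLLModel W := { M with R1 := M.R1 \ {e} }

/-- M ⊕ e : add edge `e` to R₁. -/
def addE (M : SLLModel W) (e : W × W) : SLLModel W := { M with R1 := insert e M.R1 }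

end SLLModel

/-- `edges w h` is Set(S) for the sequence `S` whose *reverse* is `w :: h`;
i.e. `w = e(S)` is the last element and `h` lists the earlier elements in reverse order. -/
def edges {W : Type} : W → List W → Set (W × W)
  | _, [] => ∅
  | w, y :: t => insert (y, w) (edges y t)

/-- `trunc e w h` is (the reversed representation of) the truncation `S|_e`:
the initial segment of `S` ending at the source of the first occurrence of `e` in `S`. -/
noncomputable def trunc {W : Type} (e : W × W) : W → List W → W × List W
  | w, [] => (w, [])
  | w, y :: t =>
    if e ∈ edges y t then trunc e y t
    else if (y, w) = e then (y, t)
    else (w, y :: t)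

/-- Truth of an SLL-formula at a pointed model: the evaluation sequence `S` is
represented in reverse as `w :: h` with `w = e(S)`. -/
def Sat {W : Type} : SLLModel W → Form → W → List W → Prop
  | M, .atom n, w, _ => w ∈ M.V n
  | M, .neg φ, w, h => ¬ Sat M φ w h
  | M, .and φ ψ, w, h => Sat M φ w h ∧ Sat M ψ w h
  | M, .dia φ, w, h => ∃ v, (w, v) ∈ M.R1 ∧ Sat M φ v (w :: h)
  | M, .rem1 φ, w, h => ∃ e, e ∈ edges w h ∧ e ∉ M.R2 ∧
      Sat (M.del e) φ (trunc e w h).1 (trunc e w h).2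
  | M, .rem2 φ, w, h => ∃ e, e ∈ M.R1 ∧ e ∉ M.R2 ∧ e ∉ edges w h ∧ Sat (M.del e) φ w h
  | M, .add φ, w, h => ∃ e, e ∈ M.R2 ∧ e ∉ M.R1 ∧ Sat (M.addE e) φ w h

/-- The fragment L_♦⟨+⟩ : only atoms, ¬, ∧, ♦ and ⟨+⟩. -/
def InDiaAddFrag : Form → Prop
  | .atom _ => True
  | .neg φ => InDiaAddFrag φ
  | .and φ ψ => InDiaAddFrag φ ∧ InDiaAddFrag ψ
  | .dia φ => InDiaAddFrag φ
  | .add φ => InDiaAddFrag φ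
  | _ => False

/-- Bridge modal formulas. -/
inductive BForm : Type
  | atom : ℕ → BForm
  | neg : BForm → BForm
  | and : BForm → BForm → BForm
  | dia : BForm → BForm     -- ◇
  | bridge : BForm → BForm  -- ⟨+⟩

/-- Bridge modal logic semantics on (W,R,V). -/
def BSat {W : Type} (V : ℕ → Set W) : BForm → Set (W × W) → W → Prop
  | .atom n, _, w => w ∈ V n
  | .neg φ, R, w => ¬ BSat V φ R w
  | .and φ ψ, R, w => BSat V φ R w ∧ BSat V ψ R w
  | .dia φ, R, w => ∃ v, (w, v) ∈ R ∧ BSat V φ R v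
  | .bridge φ, R, w => ∃ e, e ∉ R ∧ BSat V φ (insert e R) w

/-- φ⋆ : replace every ♦ by ◇ and read ⟨+⟩ as the bridge modality (arbitrary on the
other modalities, which do not occur in the fragment L_♦⟨+⟩). -/
def brTr : Form → BForm
  | .atom n => .atom n
  | .neg φ => .neg (brTr φ)
  | .and φ ψ => .and (brTr φ) (brTr ψ)
  | .dia φ => .dia (brTr φ)
  | .rem1 φ => brTr φ
  | .rem2 φ => brTr φ
  | .add φ => .bridge (brTr φ)

theorem diaAddFrag_aux (W : Type) (φ : Form) : ∀ (M : SLLModel W), M.R2 = Set.univ →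
    ∀ (w : W) (h : List W), InDiaAddFrag φ →
    (Sat M φ w h ↔ BSat M.V (brTr φ) M.R1 w) := by
  induction φ with
  | atom n => intro M _ w h _; simp [Sat, brTr, BSat]
  | neg φ ih =>
    intro M hR w h hφ
    simp only [Sat, brTr, BSat]
    exact not_congr (ih M hR w h hφ)
  | and φ ψ ih1 ih2 =>
    intro M hR w h hφ
    simp only [Sat, brTr, BSat]
    exact and_congr (ih1 M hR w h hφ.1) (ih2 M hR w h hφ.2)
  | dia φ ih =>
    intro M hR w h hφ
    simp only [Sat, brTr, BSat]
    exact exists_congr fun v => and_congr Iff.rfl (ih M hR v (w :: h) hφ)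
  | rem1 φ ih => intro M hR w h hφ; exact hφ.elim
  | rem2 φ ih => intro M hR w h hφ; exact hφ.elim
  | add φ ih =>
    intro M hR w h hφ
    simp only [Sat, brTr, BSat, hR, Set.mem_univ, true_and]
    exact exists_congr fun e => and_congr Iff.rfl (ih (M.addE e) hR w h hφ)

/-- Let M = (W,R₁,W×W,V) with total correct relation R₂ = W×W. For every φ in
L_♦⟨+⟩ and every pointed model (M,S): M,S ⊨ φ iff the bridge model (W,R₁,V)
satisfies φ⋆ at e(S). -/
theorem diaAddFrag_is_bridge (W : Type) (M : SLLModel W) (hR2 : M.R2 = Set.univ)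
    (w : W) (h : List W) (hS : edges w h ⊆ M.R1) (φ : Form) (hφ : InDiaAddFrag φ) :
    Sat M φ w h ↔ BSat M.V (brTr φ) M.R1 w := by
  exact diaAddFrag_aux W φ M hR2 w h hφ
end

section
/- For every propositional atom p, the formula p ∧ ♦⊤ → ♦[-]₁p is valid with respect to the class 𝔐•: for every model M and every world w of M, M,⟨w⟩ ⊨ p ∧ ♦⊤ → ♦[-]₁p. -/
attribute [local instance] Classical.propDecidable

/-- For every atom p, the formula p ∧ ♦⊤ → ♦[-]₁p is valid w.r.t. 𝔐•. -/
theorem atom_and_dia_top_imp_dia_boxr1_valid (p : ℕ) (W : Type) (M : SLLModel W) (w : W) :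
    Sat M (Form.imp ((Form.atom p).and (Form.dia Form.top))
      (Form.dia (Form.boxr1 (.atom p)))) w [] := by
  simp only [Form.imp, Form.or, Form.boxr1, Sat]
  rintro ⟨h1, h2⟩
  rw [not_not] at h1
  obtain ⟨hp, v, hv, -⟩ := h1
  refine h2 ⟨v, hv, ?_⟩
  rintro ⟨e, he, -, hn⟩
  have he' : e = (w, v) := by simpa [edges] using he
  subst he'
  apply hn
  simpa [trunc, edges, SLLModel.del] using hp
end

section
/- For every formula φ of L and all natural numbers n and m, the formula ■ⁿ⟨-⟩₁φ → ■ⁿ⁺ᵐ⟨-⟩₁φ (where ■ᵏ denotes k nested occurrences of ■) is valid with respect to the class 𝔐•: it is true at every pointed model (M,⟨w⟩). -/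
attribute [local instance] Classical.propDecidable

/-- ■ⁿ : n nested occurrences of ■. -/
def boxIter : ℕ → Form → Form
  | 0, φ => φ
  | n + 1, φ => Form.box (boxIter n φ)

theorem sat_box_iff {W : Type} (M : SLLModel W) (ψ : Form) (w : W) (h : List W) :
    Sat M (Form.box ψ) w h ↔ ∀ v, (w, v) ∈ M.R1 → Sat M ψ v (w :: h) := by
  simp [Form.box, Sat]

theorem sat_rem1_extend {W : Type} (M : SLLModel W) (φ : Form) (w v : W) (h : List W)
    (hs : Sat M (Form.rem1 φ) w h) : Sat M (Form.rem1 φ) v (w :: h) := by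
  simp only [Sat] at hs ⊢
  obtain ⟨e, he, h2, h3⟩ := hs
  refine ⟨e, Set.mem_insert_of_mem _ he, h2, ?_⟩
  simpa [trunc, he] using h3

theorem sat_boxIter_succ {W : Type} (M : SLLModel W) (φ : Form) (k : ℕ) :
    ∀ (w : W) (h : List W), Sat M (boxIter k (Form.rem1 φ)) w h →
      Sat M (boxIter (k + 1) (Form.rem1 φ)) w h := by
  induction k with
  | zero =>
    intro w h hs
    exact (sat_box_iff _ _ _ _).2 fun v _ => sat_rem1_extend M φ w v h hs
  | succ k ih =>
    intro w h hs
    exact (sat_box_iff _ _ _ _).2 fun v hv => ih v _ ((sat_box_iff _ _ _ _).1 hs v hv)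

/-- For every φ and all n, m : ■ⁿ⟨-⟩₁φ → ■ⁿ⁺ᵐ⟨-⟩₁φ is valid w.r.t. 𝔐•. -/
theorem boxIter_rem1_monotone_valid (φ : Form) (n m : ℕ) (W : Type) (M : SLLModel W) (w : W) :
    Sat M (Form.imp (boxIter n (Form.rem1 φ)) (boxIter (n + m) (Form.rem1 φ))) w [] := by
  have key : Sat M (boxIter n (Form.rem1 φ)) w [] →
      Sat M (boxIter (n + m) (Form.rem1 φ)) w [] := by
    intro h0
    induction m with
    | zero => exact h0
    | succ m ih => exact sat_boxIter_succ M φ (n + m) w [] ih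
  simp only [Form.imp, Form.or, Sat]
  tauto
end

section
/- For every formula φ of L and every natural number n ≥ 1, the formula ♦ⁿ⟨-⟩₁φ → ⋁_{m<n} ♦ᵐ⟨-⟩₂φ (where ♦ᵏ denotes k nested occurrences of ♦ and the disjunction ranges over all m with 0 ≤ m < n) is valid with respect to the class 𝔐•: it is true at every pointed model (M,⟨w⟩). -/
attribute [local instance] Classical.propDecidable

/-- ♦ⁿ : n nested occurrences of ♦. -/
def diaIter : ℕ → Form → Form
  | 0, φ => φ
  | n + 1, φ => Form.dia (diaIter n φ)

/-- Finite disjunction. -/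
def bigOr : List Form → Form
  | [] => Form.bot
  | φ :: l => Form.or φ (bigOr l)

theorem sat_or {W : Type} (M : SLLModel W) (φ ψ : Form) (w : W) (h : List W) :
    Sat M (Form.or φ ψ) w h ↔ (Sat M φ w h ∨ Sat M ψ w h) := by
  simp only [Form.or, Sat]
  tauto

theorem sat_bigOr {W : Type} (M : SLLModel W) (w : W) (h : List W) (φ : Form) (l : List Form)
    (hφ : φ ∈ l) (hs : Sat M φ w h) : Sat M (bigOr l) w h := by
  induction l with
  | nil => simp at hφ
  | cons a l ih =>
    simp only [bigOr]
    rw [sat_or]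
    rcases List.mem_cons.1 hφ with rfl | h'
    · exact Or.inl hs
    · exact Or.inr (ih h')

/-- Either the deleted edge is traversed after the current point, or already before it. -/
theorem diaIter_rem1_aux {W : Type} (M : SLLModel W) (φ : Form) (n : ℕ) :
    ∀ (w : W) (h : List W), Sat M (diaIter n (Form.rem1 φ)) w h →
      (∃ m < n, Sat M (diaIter m (Form.rem2 φ)) w h) ∨ Sat M (Form.rem1 φ) w h := by
  induction n with
  | zero => intro w h hs; exact Or.inr hs
  | succ n ih =>
    intro w h hs
    simp only [diaIter, Sat] at hs
    obtain ⟨v, hv, hs⟩ := hs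
    rcases ih v (w :: h) hs with ⟨m, hm, hs'⟩ | hs'
    · refine Or.inl ⟨m + 1, by omega, ?_⟩
      simp only [diaIter, Sat]
      exact ⟨v, hv, hs'⟩
    · simp only [Sat] at hs'
      obtain ⟨e, he, he2, hs'⟩ := hs'
      by_cases hc : e ∈ edges w h
      · right
        simp only [trunc, if_pos hc] at hs'
        simp only [Sat]
        exact ⟨e, hc, he2, hs'⟩
      · left
        have hev : e = (w, v) := by
          simp only [edges, Set.mem_insert_iff] at he
          tauto
        simp only [trunc, if_neg hc, if_pos hev.symm] at hs'
        refine ⟨0, by omega, ?_⟩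
        simp only [diaIter, Sat]
        exact ⟨e, hev ▸ hv, he2, hc, hs'⟩

/-- For every φ and every n ≥ 1, ♦ⁿ⟨-⟩₁φ → ⋁_{m<n} ♦ᵐ⟨-⟩₂φ is valid w.r.t. 𝔐•. -/
theorem diaIter_rem1_imp_disj_rem2_valid (φ : Form) (n : ℕ) (hn : 1 ≤ n)
    (W : Type) (M : SLLModel W) (w : W) :
    Sat M (Form.imp (diaIter n (Form.rem1 φ))
      (bigOr ((List.range n).map fun m => diaIter m (Form.rem2 φ)))) w [] := by
  rw [Form.imp, sat_or]
  by_cases hs : Sat M (diaIter n (Form.rem1 φ)) w []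
  · right
    rcases diaIter_rem1_aux M φ n w [] hs with ⟨m, hm, hs'⟩ | hs'
    · exact sat_bigOr M w [] _ _ (List.mem_map.2 ⟨m, List.mem_range.2 hm, rfl⟩) hs'
    · simp [Sat, edges] at hs'
  · left
    simpa only [Sat] using hs
end

section
/- Validities of the fragment L_♦⟨-⟩₁ are not closed under uniform substitution: while the formula p ∧ ♦q → ♦[-]₁p (p, q distinct atoms) is valid with respect to the class 𝔐•, its substitution instance ♦p ∧ ♦■q → ♦[-]₁♦p (obtained by substituting ♦p for p and ■q for q) is not valid with respect to 𝔐•; in particular, in the model M with three worlds w, w₁, w₂, R₁ = {(w,w₁)}, R₂ = {(w₁,w₂)}, V(p) = {w₁}, V(q) = {w₂}, one has M,⟨w⟩ ⊨ ♦p ∧ ♦■q but M,⟨w⟩ ⊭ ♦[-]₁♦p. -/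
attribute [local instance] Classical.propDecidable

/-- The counterexample model: worlds w = 0, w₁ = 1, w₂ = 2;
R₁ = {(w,w₁)}, R₂ = {(w₁,w₂)}, V(p) = {w₁}, V(q) = {w₂} (p = atom 0, q = atom 1). -/
def M12 : SLLModel (Fin 3) where
  R1 := {((0 : Fin 3), (1 : Fin 3))}
  R2 := {((1 : Fin 3), (2 : Fin 3))}
  V := fun n => if n = 0 then {(1 : Fin 3)} else if n = 1 then {(2 : Fin 3)} else ∅

/-- Validities of L_♦⟨-⟩₁ are not closed under uniform substitution:
p ∧ ♦q → ♦[-]₁p is valid on 𝔐• for distinct atoms p, q, but the substitution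
instance ♦p ∧ ♦■q → ♦[-]₁♦p is not valid: in the model M12 above one has
M12,⟨w⟩ ⊨ ♦p ∧ ♦■q while M12,⟨w⟩ ⊭ ♦[-]₁♦p. -/
theorem validities_not_closed_under_substitution :
    (∀ (p q : ℕ), p ≠ q → ∀ (W : Type) (M : SLLModel W) (w : W),
      Sat M (Form.imp ((Form.atom p).and (Form.dia (.atom q)))
        (Form.dia (Form.boxr1 (.atom p)))) w []) ∧
    ¬ (∀ (W : Type) (M : SLLModel W) (w : W),
      Sat M (Form.imp ((Form.dia (.atom 0)).and (Form.dia (Form.box (.atom 1))))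
        (Form.dia (Form.boxr1 (Form.dia (.atom 0))))) w []) ∧
    Sat M12 ((Form.dia (.atom 0)).and (Form.dia (Form.box (.atom 1)))) 0 [] ∧
    ¬ Sat M12 (Form.dia (Form.boxr1 (Form.dia (.atom 0)))) 0 [] := by
  have h3 : Sat M12 ((Form.dia (.atom 0)).and (Form.dia (Form.box (.atom 1)))) 0 [] := by
    refine ⟨⟨1, ?_, ?_⟩, ⟨1, ?_, ?_⟩⟩
    · simp [M12]
    · simp [M12, Sat]
    · simp [M12]
    · simp [M12, Sat, Form.box]
  have h4 : ¬ Sat M12 (Form.dia (Form.boxr1 (Form.dia (.atom 0)))) 0 [] := by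
    rintro ⟨v, hv, h⟩
    have hv1 : v = 1 := by simpa [M12] using hv
    subst hv1
    apply h
    refine ⟨(0, 1), ?_, ?_, ?_⟩
    · simp [edges]
    · simp [M12]
    · simp [Sat, trunc, edges, M12, SLLModel.del]
  refine ⟨?_, ?_, h3, h4⟩
  · intro p q _ W M w
    rintro ⟨hn, hc⟩
    apply hn
    rintro ⟨hp, v, hv, -⟩
    apply hc
    refine ⟨v, hv, ?_⟩
    rintro ⟨e, he, -, h⟩
    have he1 : e = (w, v) := by simpa [edges] using he
    subst he1
    apply h
    simpa [trunc, edges, Sat, SLLModel.del] using hp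
  · intro h
    have h0 := h (Fin 3) M12 0
    exact h0 ⟨fun hn => hn h3, h4⟩
end

section
/- Let φ_T := T₁ ∧ T₂ ∧ T₃ where T₁ = p ∧ ♦p ∧ ♦¬p, T₂ = ■(p → ♦p ∧ ♦¬p), and T₃ = ■(¬p → ⟨-⟩₁(■p ∧ ■■p)). Then: (i) for every model M = (W,R₁,R₂,V) and every w ∈ W, if M,⟨w⟩ ⊨ φ_T then (w,w) ∈ R₁; and (ii) φ_T is satisfiable with respect to 𝔐•. Consequently, the fragment L_♦⟨-⟩₁ lacks the tree model property. -/
attribute [local instance] Classical.propDecidable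

/-- T₁ = p ∧ ♦p ∧ ♦¬p   (p = atom 0). -/
def T1 : Form := (Form.atom 0).and ((Form.dia (.atom 0)).and (Form.dia (.neg (.atom 0))))

/-- T₂ = ■(p → ♦p ∧ ♦¬p). -/
def T2 : Form :=
  Form.box (Form.imp (.atom 0) ((Form.dia (.atom 0)).and (Form.dia (.neg (.atom 0)))))

/-- T₃ = ■(¬p → ⟨-⟩₁(■p ∧ ■■p)). -/
def T3 : Form :=
  Form.box (Form.imp (.neg (.atom 0))
    (Form.rem1 ((Form.box (.atom 0)).and (Form.box (Form.box (.atom 0))))))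

/-- φ_T = T₁ ∧ T₂ ∧ T₃. -/
def phiT : Form := T1.and (T2.and T3)

/-- (i) every pointed model (M,⟨w⟩) satisfying φ_T has a reflexive R₁-loop at w, and
(ii) φ_T is satisfiable w.r.t. 𝔐•; hence L_♦⟨-⟩₁ lacks the tree model property. -/
theorem phiT_forces_loop_and_satisfiable :
    (∀ (W : Type) (M : SLLModel W) (w : W), Sat M phiT w [] → (w, w) ∈ M.R1) ∧
    (∃ (W : Type) (M : SLLModel W) (w : W), Sat M phiT w []) := by
  constructor
  · intro W M w h
    simp only [phiT, T1, T2, T3, Form.box, Form.imp, Form.or, Sat, edges, trunc] at h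
    obtain ⟨⟨hw, ⟨u, hu, hup⟩, x, hx, hxp⟩, h2, h3⟩ := h
    by_contra hww
    have hy : ∃ y, (u, y) ∈ M.R1 ∧ y ∉ M.V 0 := by
      by_contra hc
      refine h2 ⟨u, hu, ?_⟩
      intro hn
      apply hn
      refine ⟨fun k => k hup, fun k => hc k.2⟩
    obtain ⟨y, hy, hyp⟩ := hy
    refine h3 ⟨x, hx, ?_⟩
    intro hn
    apply hn
    refine ⟨fun k => k hxp, ?_⟩
    rintro ⟨e, he, -, -, hbb⟩
    have he' : e = (w, x) := by simpa using he
    subst he'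
    simp only [SLLModel.del] at hbb
    have hne : u ≠ x := fun k => hxp (k ▸ hup)
    have huw : u ≠ w := fun k => hww (k ▸ hu)
    apply hbb
    simp only [Set.mem_empty_iff_false, if_false, if_true]
    refine ⟨u, ⟨hu, by simp [hne]⟩, ?_⟩
    intro k
    exact k ⟨y, ⟨hy, by simp [huw]⟩, hyp⟩
  · refine ⟨Bool, ⟨{(true, true), (true, false)}, ∅, fun _ => {true}⟩, true, ?_⟩
    simp [phiT, T1, T2, T3, Form.box, Form.imp, Form.or, Sat, edges, trunc, SLLModel.del]
end

section
/- If Z is an l-bisimulation between pointed models (M,S) and (M',S'), then (M,S) and (M',S') are learning modal equivalent: for every formula φ of L, M,S ⊨ φ if and only if M',S' ⊨ φ. -/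
attribute [local instance] Classical.propDecidable

/-- `Z` is an l-bisimulation (between pointed models over world domains `W` and `W'`,
where a pointed model is coded by the current model together with the evaluation
sequence given in reverse as `w :: h`). -/
def IsLBisim {W W' : Type}
    (Z : SLLModel W → W → List W → SLLModel W' → W' → List W' → Prop) : Prop :=
  ∀ N w h N' w' h', Z N w h N' w' h' →
    -- Atom
    (∀ n, w ∈ N.V n ↔ w' ∈ N'.V n) ∧
    -- Zig_♦
    (∀ v, (w, v) ∈ N.R1 → ∃ v', (w', v') ∈ N'.R1 ∧ Z N v (w :: h) N' v' (w' :: h')) ∧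
    -- Zag_♦
    (∀ v', (w', v') ∈ N'.R1 → ∃ v, (w, v) ∈ N.R1 ∧ Z N v (w :: h) N' v' (w' :: h')) ∧
    -- Zig_⟨-⟩₁
    (∀ e, e ∈ edges w h → e ∉ N.R2 → ∃ e', e' ∈ edges w' h' ∧ e' ∉ N'.R2 ∧
      Z (N.del e) (trunc e w h).1 (trunc e w h).2
        (N'.del e') (trunc e' w' h').1 (trunc e' w' h').2) ∧
    -- Zag_⟨-⟩₁
    (∀ e', e' ∈ edges w' h' → e' ∉ N'.R2 → ∃ e, e ∈ edges w h ∧ e ∉ N.R2 ∧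
      Z (N.del e) (trunc e w h).1 (trunc e w h).2
        (N'.del e') (trunc e' w' h').1 (trunc e' w' h').2) ∧
    -- Zig_⟨-⟩₂
    (∀ e, e ∈ N.R1 → e ∉ N.R2 → e ∉ edges w h → ∃ e', e' ∈ N'.R1 ∧ e' ∉ N'.R2 ∧
      e' ∉ edges w' h' ∧ Z (N.del e) w h (N'.del e') w' h') ∧
    -- Zag_⟨-⟩₂
    (∀ e', e' ∈ N'.R1 → e' ∉ N'.R2 → e' ∉ edges w' h' → ∃ e, e ∈ N.R1 ∧ e ∉ N.R2 ∧
      e ∉ edges w h ∧ Z (N.del e) w h (N'.del e') w' h') ∧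
    -- Zig_⟨+⟩
    (∀ e, e ∈ N.R2 → e ∉ N.R1 → ∃ e', e' ∈ N'.R2 ∧ e' ∉ N'.R1 ∧
      Z (N.addE e) w h (N'.addE e') w' h') ∧
    -- Zag_⟨+⟩
    (∀ e', e' ∈ N'.R2 → e' ∉ N'.R1 → ∃ e, e ∈ N.R2 ∧ e ∉ N.R1 ∧
      Z (N.addE e) w h (N'.addE e') w' h')

/-- If Z is an l-bisimulation relating (M,S) and (M',S'), then (M,S) and (M',S')
are learning modal equivalent: they satisfy the same L-formulas. -/
theorem lbisim_implies_equiv {W W' : Type}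
    (Z : SLLModel W → W → List W → SLLModel W' → W' → List W' → Prop)
    (hZ : IsLBisim Z) (M : SLLModel W) (w : W) (h : List W)
    (M' : SLLModel W') (w' : W') (h' : List W') (hMM' : Z M w h M' w' h') (φ : Form) :
    Sat M φ w h ↔ Sat M' φ w' h' := by
  induction φ generalizing M w h M' w' h' with
  | atom n => exact (hZ _ _ _ _ _ _ hMM').1 n
  | neg φ ih => exact not_congr (ih _ _ _ _ _ _ hMM')
  | and φ ψ ih1 ih2 => exact and_congr (ih1 _ _ _ _ _ _ hMM') (ih2 _ _ _ _ _ _ hMM')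
  | dia φ ih =>
    obtain ⟨-, zig, zag, -⟩ := hZ _ _ _ _ _ _ hMM'
    constructor
    · rintro ⟨v, hv, hs⟩
      obtain ⟨v', hv', hz⟩ := zig v hv
      exact ⟨v', hv', (ih _ _ _ _ _ _ hz).1 hs⟩
    · rintro ⟨v', hv', hs⟩
      obtain ⟨v, hv, hz⟩ := zag v' hv'
      exact ⟨v, hv, (ih _ _ _ _ _ _ hz).2 hs⟩
  | rem1 φ ih =>
    obtain ⟨-, -, -, zig, zag, -⟩ := hZ _ _ _ _ _ _ hMM'
    constructor
    · rintro ⟨e, h1, h2, hs⟩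
      obtain ⟨e', h1', h2', hz⟩ := zig e h1 h2
      exact ⟨e', h1', h2', (ih _ _ _ _ _ _ hz).1 hs⟩
    · rintro ⟨e', h1', h2', hs⟩
      obtain ⟨e, h1, h2, hz⟩ := zag e' h1' h2'
      exact ⟨e, h1, h2, (ih _ _ _ _ _ _ hz).2 hs⟩
  | rem2 φ ih =>
    obtain ⟨-, -, -, -, -, zig, zag, -⟩ := hZ _ _ _ _ _ _ hMM'
    constructor
    · rintro ⟨e, h1, h2, h3, hs⟩
      obtain ⟨e', h1', h2', h3', hz⟩ := zig e h1 h2 h3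
      exact ⟨e', h1', h2', h3', (ih _ _ _ _ _ _ hz).1 hs⟩
    · rintro ⟨e', h1', h2', h3', hs⟩
      obtain ⟨e, h1, h2, h3, hz⟩ := zag e' h1' h2' h3'
      exact ⟨e, h1, h2, h3, (ih _ _ _ _ _ _ hz).2 hs⟩
  | add φ ih =>
    obtain ⟨-, -, -, -, -, -, -, zig, zag⟩ := hZ _ _ _ _ _ _ hMM'
    constructor
    · rintro ⟨e, h1, h2, hs⟩
      obtain ⟨e', h1', h2', hz⟩ := zig e h1 h2
      exact ⟨e', h1', h2', (ih _ _ _ _ _ _ hz).1 hs⟩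
    · rintro ⟨e', h1', h2', hs⟩
      obtain ⟨e, h1, h2, hz⟩ := zag e' h1' h2'
      exact ⟨e, h1, h2, (ih _ _ _ _ _ _ hz).2 hs⟩
end

section
/- The fragment L_♦⟨-⟩₁ does not have the finite model property: there exists a formula φ of L_♦⟨-⟩₁ that is satisfiable with respect to the class 𝔐• (i.e., M,⟨w⟩ ⊨ φ for some model M and world w), but such that every model M = (W,R₁,R₂,V) satisfying M,⟨w⟩ ⊨ φ at some world w has an infinite domain W. -/
attribute [local instance] Classical.propDecidable

/-- The fragment L_♦⟨-⟩₁ : only atoms, ¬, ∧, ♦ and ⟨-⟩₁. -/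
def InDiaRem1Frag : Form → Prop
  | .atom _ => True
  | .neg φ => InDiaRem1Frag φ
  | .and φ ψ => InDiaRem1Frag φ ∧ InDiaRem1Frag ψ
  | .dia φ => InDiaRem1Frag φ
  | .rem1 φ => InDiaRem1Frag φ
  | _ => False

/-! ### The formula

The single atom `P` marks points; the root and the flags are the worlds where it fails. A point is
marked by deleting its only edge to a flag. -/

namespace NoFMP

/-- Being a point. -/
def P : Form := .atom 0
/-- Being the root or a flag. -/
def nP : Form := .neg P
/-- Being a point without a flag. -/
def mk : Form := .and P (.neg (.dia nP))
/-- The universal modality along `R₁`. -/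
def bx (φ : Form) : Form := .neg (.dia (.neg φ))
/-- Implication from being a point. -/
def ifP (φ : Form) : Form := .neg (.and P (.neg φ))

/-- The root sees only points, and at least one. -/
def A1 : Form := .and nP (.and (.dia P) (bx P))
/-- Points have a flag, and see a point. -/
def A2 : Form := bx (.and (.dia nP) (.dia P))
/-- Irreflexivity. -/
def A3 : Form := bx (.dia (.and nP (.rem1 (.and mk (bx (.dia nP))))))
/-- The root sees the points seen by points it sees. -/
def A4 : Form := bx (bx (ifP (.dia (.and nP (.rem1 (.and mk (.rem1 (.and nP (.dia mk)))))))))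
/-- Transitivity. -/
def A5 : Form :=
  bx (bx (ifP (bx (ifP (.dia (.and nP (.rem1 (.and mk (.rem1 (.and P (.dia mk)))))))))))

/-- The formula with only infinite models. -/
def Phi : Form := .and A1 (.and A2 (.and A3 (.and A4 A5)))

section sound
variable {W : Type} (M : SLLModel W)

theorem sat_bx (φ : Form) (w : W) (h : List W) :
    Sat M (bx φ) w h ↔ ∀ v, (w, v) ∈ M.R1 → Sat M φ v (w :: h) := by
  simp [bx, Sat]

theorem sat_ifP (φ : Form) (w : W) (h : List W) :
    Sat M (ifP φ) w h ↔ (w ∈ M.V 0 → Sat M φ w h) := by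
  simp [ifP, P, Sat]

theorem sat_mk (w : W) (h : List W) :
    Sat M mk w h ↔ (w ∈ M.V 0 ∧ ∀ v, (w, v) ∈ M.R1 → v ∈ M.V 0) := by
  simp [mk, nP, P, Sat]

theorem sat_dia (φ : Form) (w : W) (h : List W) :
    Sat M (.dia φ) w h ↔ ∃ v, (w, v) ∈ M.R1 ∧ Sat M φ v (w :: h) := by
  simp [Sat]

theorem sat_P (w : W) (h : List W) : Sat M P w h ↔ w ∈ M.V 0 := by simp [P, Sat]

theorem sat_nP (w : W) (h : List W) : Sat M nP w h ↔ w ∉ M.V 0 := by simp [nP, P, Sat]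

theorem sat_and (φ ψ : Form) (w : W) (h : List W) :
    Sat M (.and φ ψ) w h ↔ (Sat M φ w h ∧ Sat M ψ w h) := by simp [Sat]

theorem sat_rem1 (φ : Form) (w : W) (h : List W) :
    Sat M (.rem1 φ) w h ↔ ∃ e, e ∈ edges w h ∧ e ∉ M.R2 ∧
      Sat (M.del e) φ (trunc e w h).1 (trunc e w h).2 := by simp [Sat]

theorem mem_del (e d : W × W) : d ∈ (M.del e).R1 ↔ d ∈ M.R1 ∧ d ≠ e := by
  simp [SLLModel.del]

theorem del_R2 (e : W × W) : (M.del e).R2 = M.R2 := rfl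

theorem del_V (e : W × W) (n : ℕ) : (M.del e).V n = M.V n := rfl

theorem irrefl_of {s x : W} (hs : s ∉ M.V 0) (hx : x ∈ M.V 0)
    (h : Sat M (.dia (.and nP (.rem1 (.and mk (bx (.dia nP)))))) x [s]) : (x, x) ∉ M.R1 := by
  intro hxx
  simp only [sat_dia, sat_and, sat_nP, sat_rem1, sat_mk, sat_bx, mem_del, del_V] at h
  obtain ⟨f, hxf, hf, e, he, -, ⟨h1, h2⟩, h3⟩ := h
  have hsx : x ≠ s := fun h => hs (h ▸ hx)
  have hxf' : x ≠ f := fun h => hf (h ▸ hx)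
  simp only [edges, Set.mem_insert_iff, Set.mem_empty_iff_false, or_false] at he
  rcases he with rfl | rfl
  · have ht : trunc (x, f) f [x, s] = (x, [s]) := by
      simp [trunc, edges, hsx]
    rw [ht] at h1 h2 h3
    obtain ⟨v, ⟨hv, hv'⟩, hv2⟩ := h3 x ⟨hxx, by simpa using hxf'⟩
    exact hv2 (h2 v ⟨hv, hv'⟩)
  · have ht : trunc (s, x) f [x, s] = (s, []) := by
      simp [trunc, edges]
    rw [ht] at h1
    exact hs h1

theorem closed_of {s x y : W} (hs : s ∉ M.V 0) (hx : x ∈ M.V 0) (hy : y ∈ M.V 0)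
    (hxy : x ≠ y)
    (hflag : ∀ v, (s, v) ∈ M.R1 → ∃ f, (v, f) ∈ M.R1 ∧ f ∉ M.V 0)
    (hsx : (s, x) ∈ M.R1)
    (h : Sat M (.dia (.and nP (.rem1 (.and mk (.rem1 (.and nP (.dia mk))))))) y [x, s]) :
    (s, y) ∈ M.R1 := by
  simp only [sat_dia, sat_and, sat_nP, sat_rem1, sat_mk, mem_del, del_V] at h
  obtain ⟨g, hyg, hg, e, he, -, ⟨h1, h2⟩, d, hd, -, h3, v, ⟨⟨hv1, hv2⟩, hv3⟩, hv4, hv5⟩ := h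
  have n1 : x ≠ s := fun h => hs (h ▸ hx)
  have n2 : y ≠ s := fun h => hs (h ▸ hy)
  have n3 : y ≠ g := fun h => hg (h ▸ hy)
  obtain ⟨f, hxf, hf⟩ := hflag x hsx
  have n4 : f ≠ y := fun h => hf (h ▸ hy)
  simp only [edges, Set.mem_insert_iff, Set.mem_empty_iff_false, or_false] at he
  rcases he with rfl | rfl | rfl
  · have ht : trunc (y, g) g [y, x, s] = (y, [x, s]) := by
      simp [trunc, edges, n1, n2, hxy.symm]
    simp only [ht] at hd h3 hv1 hv2 hv3
    simp only [edges, Set.mem_insert_iff, Set.mem_empty_iff_false, or_false] at hd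
    rcases hd with rfl | rfl
    · have ht' : trunc (x, y) y [x, s] = (x, [s]) := by
        simp [trunc, edges, n1]
      rw [ht'] at h3
      exact absurd hx h3
    · have ht' : trunc (s, x) y [x, s] = (s, []) := by
        simp [trunc, edges]
      simp only [ht'] at hv1 hv2 hv3
      obtain ⟨k, hk, hk'⟩ := hflag v hv1
      by_cases hvy : v = y
      · exact hvy ▸ hv1
      · exact absurd (hv5 k ⟨⟨hk, by simp [hvy]⟩, by
          rintro ⟨⟩; exact hs hv4⟩) hk'
  · have ht : trunc (x, y) g [y, x, s] = (x, [s]) := by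
      simp [trunc, edges, n1]
    rw [ht] at h1 h2
    exact absurd (h2 f ⟨hxf, by simp [n4]⟩) hf
  · have ht : trunc (s, x) g [y, x, s] = (s, []) := by
      simp [trunc, edges]
    rw [ht] at h1
    exact absurd h1 hs

theorem trans_of {s x y z : W} (hs : s ∉ M.V 0) (hx : x ∈ M.V 0) (hy : y ∈ M.V 0)
    (hz : z ∈ M.V 0) (hxy : x ≠ y) (hyz : y ≠ z)
    (hflag : ∀ v, (s, v) ∈ M.R1 → ∃ f, (v, f) ∈ M.R1 ∧ f ∉ M.V 0)
    (hcl : ∀ u v, (s, u) ∈ M.R1 → (u, v) ∈ M.R1 → v ∈ M.V 0 → (s, v) ∈ M.R1)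
    (hsx : (s, x) ∈ M.R1) (hsy : (s, y) ∈ M.R1) (hirr : (x, x) ∉ M.R1)
    (hRxy : (x, y) ∈ M.R1)
    (h : Sat M (.dia (.and nP (.rem1 (.and mk (.rem1 (.and P (.dia mk))))))) z [y, x, s]) :
    (x, z) ∈ M.R1 := by
  simp only [sat_dia, sat_and, sat_nP, sat_P, sat_rem1, sat_mk, mem_del, del_V] at h
  obtain ⟨g, hzg, hg, e, he, -, ⟨h1, h2⟩, d, hd, -, h3, v, ⟨⟨hv1, hv2⟩, hv3⟩, hv4, hv5⟩ := h
  have n1 : x ≠ s := fun h => hs (h ▸ hx)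
  have n2 : y ≠ s := fun h => hs (h ▸ hy)
  have n3 : z ≠ s := fun h => hs (h ▸ hz)
  have n4 : y ≠ g := fun h => hg (h ▸ hy)
  have n5 : z ≠ g := fun h => hg (h ▸ hz)
  obtain ⟨f, hxf, hf⟩ := hflag x hsx
  obtain ⟨k, hyk, hk⟩ := hflag y hsy
  have n6 : f ≠ y := fun h => hf (h ▸ hy)
  have n7 : k ≠ z := fun h => hk (h ▸ hz)
  simp only [edges, Set.mem_insert_iff, Set.mem_empty_iff_false, or_false] at he
  rcases he with rfl | rfl | rfl | rfl
  · have ht : trunc (z, g) g [z, y, x, s] = (z, [y, x, s]) := by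
      simp [trunc, edges, n3, n4.symm, n5.symm, hyz.symm]
    simp only [ht] at hd h3 hv1 hv2 hv3
    simp only [edges, Set.mem_insert_iff, Set.mem_empty_iff_false, or_false] at hd
    rcases hd with rfl | rfl | rfl
    · have ht' : trunc (y, z) z [y, x, s] = (y, [x, s]) := by
        simp [trunc, edges, n2, hxy.symm]
      simp only [ht'] at hv1 hv2 hv3
      obtain ⟨l, hl, hl'⟩ := hflag v (hcl y v hsy hv1 hv4)
      have hvz : v ≠ z := by rintro rfl; exact hv3 rfl
      exact absurd (hv5 l ⟨⟨hl, by simp [hvz]⟩, by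
        rintro ⟨⟩; exact hl' hz⟩) hl'
    · have ht' : trunc (x, y) z [y, x, s] = (x, [s]) := by
        simp [trunc, edges, n1]
      simp only [ht'] at hv1 hv2 hv3
      obtain ⟨l, hl, hl'⟩ := hflag v (hcl x v hsx hv1 hv4)
      by_cases hvz : v = z
      · exact hvz ▸ hv1
      · exact absurd (hv5 l ⟨⟨hl, by simp [hvz]⟩, by
          rintro ⟨⟩; exact hl' hy⟩) hl'
    · have ht' : trunc (s, x) z [y, x, s] = (s, []) := by
        simp [trunc, edges]
      rw [ht'] at h3
      exact absurd h3 hs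
  · have ht : trunc (y, z) g [z, y, x, s] = (y, [x, s]) := by
      simp [trunc, edges, n2, hxy.symm]
    rw [ht] at h1 h2
    exact absurd (h2 k ⟨hyk, by simp [n7]⟩) hk
  · have ht : trunc (x, y) g [z, y, x, s] = (x, [s]) := by
      simp [trunc, edges, n1]
    rw [ht] at h1 h2
    exact absurd (h2 f ⟨hxf, by simp [n6]⟩) hf
  · have ht : trunc (s, x) g [z, y, x, s] = (s, []) := by
      simp [trunc, edges]
    rw [ht] at h1
    exact absurd h1 hs

theorem infinite_of_sat (s : W) (h : Sat M Phi s []) : Infinite W := by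
  rw [Phi, sat_and, sat_and, sat_and, sat_and] at h
  obtain ⟨h1, h2, h3, h4, h5⟩ := h
  simp only [A1, sat_and, sat_nP, sat_dia, sat_bx, sat_P] at h1
  obtain ⟨hs, ⟨x0, hx0, -⟩, hP⟩ := h1
  simp only [A2, sat_and, sat_nP, sat_dia, sat_bx, sat_P] at h2
  have hflag := fun v hv => (h2 v hv).1
  have hser := fun v hv => (h2 v hv).2
  rw [A3, sat_bx] at h3
  have hirr : ∀ x, (s, x) ∈ M.R1 → (x, x) ∉ M.R1 :=
    fun x hx => irrefl_of M hs (hP x hx) (h3 x hx)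
  have hne : ∀ x y, (s, x) ∈ M.R1 → (x, y) ∈ M.R1 → x ≠ y := by
    rintro x y hx hxy rfl
    exact hirr x hx hxy
  have hcl : ∀ u v, (s, u) ∈ M.R1 → (u, v) ∈ M.R1 → v ∈ M.V 0 → (s, v) ∈ M.R1 := by
    intro u v hu huv hv
    rw [A4, sat_bx] at h4
    have h := h4 u hu
    rw [sat_bx] at h
    have h := h v huv
    rw [sat_ifP] at h
    exact closed_of M hs (hP u hu) hv (hne u v hu huv) hflag hu (h hv)
  have htr : ∀ x y z, (s, x) ∈ M.R1 → (x, y) ∈ M.R1 → (y, z) ∈ M.R1 → y ∈ M.V 0 →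
      z ∈ M.V 0 → (x, z) ∈ M.R1 := by
    intro x y z hx hxy hyz hy hz
    rw [A5, sat_bx] at h5
    have h := h5 x hx
    rw [sat_bx] at h
    have h := h y hxy
    rw [sat_ifP] at h
    have h := h hy
    rw [sat_bx] at h
    have h := h z hyz
    rw [sat_ifP] at h
    have hsy := hcl x y hx hxy hy
    exact trans_of M hs (hP x hx) hy hz (hne x y hx hxy) (hne y z hsy hyz) hflag hcl hx hsy
      (hirr x hx) hxy (h hz)
  let D := {x : W // (s, x) ∈ M.R1}
  let r : D → D → Prop := fun a b => (a.1, b.1) ∈ M.R1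
  by_contra hfin
  rw [not_infinite_iff_finite] at hfin
  have : Finite D := inferInstance
  have i1 : IsTrans D (Function.swap r) :=
    ⟨fun a b c hab hbc => htr c.1 b.1 a.1 c.2 hbc hab (hP _ b.2) (hP _ a.2)⟩
  have i2 : Std.Irrefl (Function.swap r) := ⟨fun a => hirr a.1 a.2⟩
  have wf : WellFounded (Function.swap r) := Finite.wellFounded_of_trans_of_irrefl _
  obtain ⟨m, -, hm⟩ := wf.has_min Set.univ ⟨⟨x0, hx0⟩, trivial⟩
  obtain ⟨y, hy, hyP⟩ := hser m.1 m.2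
  exact hm ⟨y, hcl m.1 y m.2 hy hyP⟩ trivial hy

end sound

section model

/-- Worlds of the infinite model. -/
inductive Wd : Type
  | root : Wd
  | flag : Wd
  | pt : ℕ → Wd

/-- The accessibility relation of the infinite model. -/
inductive Acc : Wd × Wd → Prop
  | r (n : ℕ) : Acc (.root, .pt n)
  | f (n : ℕ) : Acc (.pt n, .flag)
  | lt {m n : ℕ} : m < n → Acc (.pt m, .pt n)

/-- The infinite model. -/
def N : SLLModel Wd := ⟨{e | Acc e}, ∅, fun _ => {w | ∃ n, w = .pt n}⟩

theorem N_root (v : Wd) : (Wd.root, v) ∈ N.R1 ↔ ∃ n, v = .pt n := by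
  constructor
  · rintro ⟨⟩; exact ⟨_, rfl⟩
  · rintro ⟨n, rfl⟩; exact .r n

theorem N_pt (m : ℕ) (v : Wd) :
    (Wd.pt m, v) ∈ N.R1 ↔ (v = .flag ∨ ∃ n, m < n ∧ v = .pt n) := by
  constructor
  · rintro (_ | _ | h)
    · exact .inl rfl
    · exact .inr ⟨_, h, rfl⟩
  · rintro (rfl | ⟨n, h, rfl⟩)
    · exact .f m
    · exact .lt h

theorem N_R2 (e : Wd × Wd) : e ∉ N.R2 := id

theorem N_V (w : Wd) : w ∈ N.V 0 ↔ ∃ n, w = .pt n := Iff.rfl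

theorem N_sat : Sat N Phi .root [] := by
  rw [Phi, sat_and, sat_and, sat_and, sat_and]
  refine ⟨?_, ?_, ?_, ?_, ?_⟩
  · simp [A1, sat_and, sat_nP, sat_dia, sat_bx, sat_P, N_root, N_V]
  · simp only [A2, sat_and, sat_nP, sat_dia, sat_bx, sat_P, N_root, N_V]
    rintro _ ⟨n, rfl⟩
    exact ⟨⟨.flag, .f n, by simp⟩, ⟨.pt (n + 1), .lt (by omega), _, rfl⟩⟩
  · rw [A3, sat_bx]
    intro v hv
    obtain ⟨n, rfl⟩ := (N_root v).1 hv
    simp only [sat_dia, sat_and, sat_nP, sat_rem1, sat_mk, sat_bx, mem_del, del_V, N_V]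
    have ht : trunc (Wd.pt n, Wd.flag) .flag [.pt n, .root] = (.pt n, [.root]) := by
      simp [trunc, edges]
    refine ⟨.flag, .f n, by simp, (.pt n, .flag), by simp [edges], N_R2 _, ?_⟩
    rw [ht]
    simp only [N_pt]
    refine ⟨⟨⟨n, rfl⟩, ?_⟩, ?_⟩
    · rintro v ⟨rfl | ⟨k, -, rfl⟩, h⟩
      · exact absurd rfl h
      · exact ⟨k, rfl⟩
    · rintro v ⟨rfl | ⟨k, hk, rfl⟩, h⟩
      · exact absurd rfl h
      · exact ⟨.flag, ⟨.f k, by simp; omega⟩, by simp⟩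
  · rw [A4, sat_bx]
    intro v hv
    obtain ⟨x, rfl⟩ := (N_root v).1 hv
    rw [sat_bx]
    intro v hv
    rw [sat_ifP]
    rintro ⟨y, rfl⟩
    have hxy : x < y := by rcases hv with _ | _ | h; exact h
    simp only [sat_dia, sat_and, sat_nP, sat_rem1, sat_mk, mem_del, del_V, del_R2, N_V]
    have ht : trunc (Wd.pt y, Wd.flag) .flag [.pt y, .pt x, .root] =
        (.pt y, [.pt x, .root]) := by
      simp [trunc, edges]
    have ht' : trunc (Wd.root, Wd.pt x) (.pt y) [.pt x, .root] = (.root, []) := by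
      simp [trunc, edges]
    refine ⟨.flag, .f y, by simp, (.pt y, .flag), by simp [edges], N_R2 _, ?_⟩
    rw [ht]
    refine ⟨⟨⟨y, rfl⟩, ?_⟩, (.root, .pt x), by simp [edges], N_R2 _, ?_⟩
    · simp only [N_pt]
      rintro v ⟨rfl | ⟨k, -, rfl⟩, h⟩
      · exact absurd rfl h
      · exact ⟨k, rfl⟩
    · rw [ht']
      refine ⟨by simp, .pt y, ⟨⟨.r y, by simp⟩, by simp; omega⟩, ⟨y, rfl⟩, ?_⟩
      simp only [N_pt]
      rintro v ⟨⟨rfl | ⟨k, -, rfl⟩, h⟩, -⟩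
      · exact absurd rfl h
      · exact ⟨k, rfl⟩
  · rw [A5, sat_bx]
    intro v hv
    obtain ⟨x, rfl⟩ := (N_root v).1 hv
    rw [sat_bx]
    intro v hv
    rw [sat_ifP]
    rintro ⟨y, rfl⟩
    have hxy : x < y := by rcases hv with _ | _ | h; exact h
    rw [sat_bx]
    intro v hv
    rw [sat_ifP]
    rintro ⟨z, rfl⟩
    have hyz : y < z := by rcases hv with _ | _ | h; exact h
    simp only [sat_dia, sat_and, sat_nP, sat_P, sat_rem1, sat_mk, mem_del, del_V, del_R2, N_V]
    have ht : trunc (Wd.pt z, Wd.flag) .flag [.pt z, .pt y, .pt x, .root] =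
        (.pt z, [.pt y, .pt x, .root]) := by
      simp [trunc, edges]
    have ht' : trunc (Wd.pt x, Wd.pt y) (.pt z) [.pt y, .pt x, .root] =
        (.pt x, [.root]) := by
      simp [trunc, edges]
    refine ⟨.flag, .f z, by simp, (.pt z, .flag), by simp [edges], N_R2 _, ?_⟩
    rw [ht]
    refine ⟨⟨⟨z, rfl⟩, ?_⟩, (.pt x, .pt y), by simp [edges], N_R2 _, ?_⟩
    · simp only [N_pt]
      rintro v ⟨rfl | ⟨k, -, rfl⟩, h⟩
      · exact absurd rfl h
      · exact ⟨k, rfl⟩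
    · rw [ht']
      refine ⟨⟨x, rfl⟩, .pt z, ⟨⟨.lt (by omega), by simp⟩, by simp; omega⟩, ⟨z, rfl⟩, ?_⟩
      simp only [N_pt]
      rintro v ⟨⟨rfl | ⟨k, -, rfl⟩, h⟩, -⟩
      · exact absurd rfl h
      · exact ⟨k, rfl⟩

end model

end NoFMP

/-- L_♦⟨-⟩₁ lacks the finite model property: some formula of the fragment is
satisfiable w.r.t. 𝔐• but only in models with an infinite domain. -/
theorem diaRem1Frag_no_fmp :
    ∃ φ : Form, InDiaRem1Frag φ ∧
      (∃ (W : Type) (M : SLLModel W) (w : W), Sat M φ w []) ∧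
      (∀ (W : Type) (M : SLLModel W) (w : W), Sat M φ w [] → Infinite W) := by
  exact ⟨NoFMP.Phi, by
    simp [NoFMP.Phi, NoFMP.A1, NoFMP.A2, NoFMP.A3, NoFMP.A4, NoFMP.A5, NoFMP.bx, NoFMP.ifP,
      NoFMP.mk, NoFMP.nP, NoFMP.P, InDiaRem1Frag], ⟨_, NoFMP.N, .root, NoFMP.N_sat⟩,
    fun _ M w h => NoFMP.infinite_of_sat M w h⟩
end

section
/- The satisfiability problem for the fragment L_♦⟨-⟩₁ is undecidable: taking atoms indexed by natural numbers (so that formulas of L_♦⟨-⟩₁ form an encodable/denumerable type), the set of formulas of L_♦⟨-⟩₁ that are satisfiable with respect to the class 𝔐• is not a decidable (computable) predicate. -/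
attribute [local instance] Classical.propDecidable

/-- An injective numerical coding of formulas. -/
def Form.encode : Form → ℕ
  | .atom n => Nat.pair 0 n
  | .neg φ => Nat.pair 1 φ.encode
  | .and φ ψ => Nat.pair 2 (Nat.pair φ.encode ψ.encode)
  | .dia φ => Nat.pair 3 φ.encode
  | .rem1 φ => Nat.pair 4 φ.encode
  | .rem2 φ => Nat.pair 5 φ.encode
  | .add φ => Nat.pair 6 φ.encode


set_option linter.unusedSimpArgs false

namespace SLLUndec

open Form

section basics
variable {W : Type}

theorem sat_top (M : SLLModel W) (w : W) (h : List W) : Sat M top w h := by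
  simp [top, bot, Sat]

theorem sat_imp (M : SLLModel W) (φ ψ : Form) (w : W) (h : List W) :
    Sat M (imp φ ψ) w h ↔ (Sat M φ w h → Sat M ψ w h) := by
  simp [imp, Form.or, Sat]

theorem sat_box (M : SLLModel W) (φ : Form) (w : W) (h : List W) :
    Sat M (box φ) w h ↔ ∀ v, (w, v) ∈ M.R1 → Sat M φ v (w :: h) := by
  simp [box, Sat]

/-- conjunction of a list of formulas -/
def conj : List Form → Form
  | [] => top
  | φ :: l => φ.and (conj l)

theorem sat_conj (M : SLLModel W) (l : List Form) (w : W) (h : List W) :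
    Sat M (conj l) w h ↔ ∀ φ ∈ l, Sat M φ w h := by
  induction l with
  | nil => simp [conj, sat_top]
  | cons a l ih => simp [conj, Sat, ih]

/-- no atom below `n` holds -/
def lo : ℕ → Form
  | 0 => top
  | n + 1 => (lo n).and (.neg (.atom n))

/-- the least true atom is `n` -/
def T (n : ℕ) : Form := (lo n).and (.atom n)

/-- the world `x` has type `n`: its least true atom is `n` -/
def Ty (M : SLLModel W) (x : W) (n : ℕ) : Prop := (∀ j < n, x ∉ M.V j) ∧ x ∈ M.V n

theorem sat_T (M : SLLModel W) (n : ℕ) (w : W) (h : List W) :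
    Sat M (T n) w h ↔ Ty M w n := by
  have key : ∀ n, Sat M (lo n) w h ↔ ∀ j < n, w ∉ M.V j := by
    intro n
    induction n with
    | zero => simp [lo, sat_top]
    | succ n ih =>
      simp only [lo, Sat, ih]
      constructor
      · rintro ⟨h1, h2⟩ j hj
        rcases Nat.lt_succ_iff_lt_or_eq.1 hj with h | rfl
        · exact h1 j h
        · exact h2
      · intro h1
        exact ⟨fun j hj => h1 j (by omega), h1 n (by omega)⟩
  simp [T, Sat, key, Ty]

theorem Ty.inj {M : SLLModel W} {x : W} {n m : ℕ} (h1 : Ty M x n) (h2 : Ty M x m) : n = m := by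
  rcases lt_trichotomy n m with h | h | h
  · exact absurd h1.2 (h2.1 n h)
  · exact h
  · exact absurd h2.2 (h1.1 m h)

@[simp] theorem Ty_del (M : SLLModel W) (e : W × W) (x : W) (n : ℕ) :
    Ty (M.del e) x n ↔ Ty M x n := Iff.rfl

/-- type of the `i`-th mark -/
def tM (i : ℕ) : ℕ := 5 + 3 * i
/-- type of handles of colour `i` -/
def tH (i : ℕ) : ℕ := 6 + 3 * i
/-- type of facts of predicate `P` -/
def tF (P : ℕ) : ℕ := 7 + 3 * P

/-- mark the current point with mark `i`, return to the root and evaluate `φ` -/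
def mark (i : ℕ) (φ : Form) : Form :=
  .dia ((T (tM i)).and (.rem1 ((T 1).and ((Form.neg (.dia (T (tM i)))).and
    (.rem1 ((T 0).and φ))))))

theorem mark_iff (N : SLLModel W) (i j : ℕ) (φ : Form) (w y x : W)
    (hw : Ty N w 0) (hy : Ty N y (tH j)) (hx : Ty N x 1) :
    Sat N (mark i φ) x [y, w] ↔ ∃ m, (x, m) ∈ N.R1 ∧ Ty N m (tM i) ∧ (x, m) ∉ N.R2 ∧
      (w, y) ∉ N.R2 ∧ (∀ m', (x, m') ∈ N.R1 → Ty N m' (tM i) → m' = m) ∧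
      Sat ((N.del (x, m)).del (w, y)) φ w [] := by
  have hwy : w ≠ y := by rintro rfl; have := hw.inj hy; unfold tH at this; omega
  have hwx : w ≠ x := by rintro rfl; have := hw.inj hx; simp at this
  have hyx : y ≠ x := by rintro rfl; have := hy.inj hx; unfold tH at this; omega
  have t1 : ∀ m, trunc (x, m) m [x, y, w] = (x, [y, w]) := by
    intro m
    simp [trunc, edges, hwx.symm, hyx.symm]
  have t2 : trunc (w, y) x [y, w] = (w, []) := by
    simp [trunc, edges]
  simp only [mark, Sat, sat_T]
  constructor
  · rintro ⟨m, hxm, hm, e, he, heR, h1, h2, e', he', heR', h3, h4⟩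
    refine ⟨m, hxm, hm, ?_⟩
    have hee : e = (x, m) := by
      simp only [edges, Set.mem_insert_iff, Set.mem_empty_iff_false, or_false] at he
      rcases he with rfl | rfl | rfl
      · rfl
      · exfalso
        have : trunc (y, x) m [x, y, w] = (y, [w]) := by
          simp [trunc, edges, hwy.symm]
        rw [this] at h1
        have := hy.inj h1
        unfold tH at this; omega
      · exfalso
        have : trunc (w, y) m [x, y, w] = (w, []) := by
          simp [trunc, edges]
        rw [this] at h1
        have := hw.inj h1
        simp at this
    subst hee
    rw [t1] at h1 h2 he' h3 h4
    have hee : e' = (w, y) := by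
      simp only [edges, Set.mem_insert_iff, Set.mem_empty_iff_false, or_false] at he'
      rcases he' with rfl | rfl
      · exfalso
        have : trunc (y, x) x [y, w] = (y, [w]) := by
          simp [trunc, edges, hwy.symm]
        rw [this] at h3
        have := hy.inj h3
        unfold tH at this; omega
      · rfl
    subst hee
    rw [t2] at h3 h4
    refine ⟨heR, heR', ?_, h4⟩
    intro m' hm' hty
    by_contra hne
    exact h2 ⟨m', ⟨hm', by simpa using hne⟩, hty⟩
  · rintro ⟨m, hxm, hm, hR, hR', hu, hs⟩
    refine ⟨m, hxm, hm, (x, m), by simp [edges], hR, ?_⟩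
    rw [t1]
    refine ⟨hx, ?_, (w, y), by simp [edges], hR', ?_⟩
    · rintro ⟨m', ⟨h1, h2⟩, h3⟩
      exact h2 (by simp [hu m' h1 h3])
    · rw [t2]
      exact ⟨hw, hs⟩

/-- First-order formulas over ternary predicates. -/
inductive FO : Type
  | rel : ℕ → ℕ → ℕ → ℕ → FO
  | neg : FO → FO
  | and : FO → FO → FO
  | all : ℕ → FO → FO

/-- truth in the relational structure `(dom, r)` -/
def FSat {X : Type} (dom : X → Prop) (r : ℕ → X → X → X → Prop) : FO → (ℕ → X) → Prop
  | .rel P a b c, ρ => r P (ρ a) (ρ b) (ρ c)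
  | .neg φ, ρ => ¬ FSat dom r φ ρ
  | .and φ ψ, ρ => FSat dom r φ ρ ∧ FSat dom r ψ ρ
  | .all i φ, ρ => ∀ x, dom x → FSat dom r φ (Function.update ρ i x)

/-- variables are below `K`, bound at most once on each branch, atoms only use bound variables -/
def WF (K : ℕ) : List ℕ → FO → Prop
  | I, .rel _ a b c => a ∈ I ∧ b ∈ I ∧ c ∈ I
  | I, .neg φ => WF K I φ
  | I, .and φ ψ => WF K I φ ∧ WF K I ψ
  | I, .all i φ => i < K ∧ i ∉ I ∧ WF K (i :: I) φ

/-- some `p`-successor sees the point marked `a` -/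
def posF (t a : ℕ) : Form :=
  .dia ((T t).and (.dia ((T 1).and (.neg (.dia (T (tM a)))))))

/-- translation of first-order formulas -/
def tr : FO → Form
  | .rel P a b c => .dia ((T (tF P)).and ((posF 2 a).and ((posF 3 b).and (posF 4 c))))
  | .neg φ => .neg (tr φ)
  | .and φ ψ => .and (tr φ) (tr ψ)
  | .all i φ => box (imp (T (tH i)) (box (imp (T 1) (mark i (tr φ)))))

structure Base (K : ℕ) (M : SLLModel W) (w : W) : Prop where
  root : Ty M w 0
  mrk : ∀ i < K, ∀ j < K, ∀ y x, (w, y) ∈ M.R1 → Ty M y (tH j) → (y, x) ∈ M.R1 → Ty M x 1 →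
    (w, y) ∉ M.R2 ∧ ∃ m, (x, m) ∈ M.R1 ∧ Ty M m (tM i) ∧ (x, m) ∉ M.R2 ∧
      ∀ m', (x, m') ∈ M.R1 → Ty M m' (tM i) → m' = m
  hdl : ∀ i < K, ∀ j < K, ∀ y x, (w, y) ∈ M.R1 → Ty M y (tH j) → (y, x) ∈ M.R1 → Ty M x 1 →
    ∃ y', (w, y') ∈ M.R1 ∧ Ty M y' (tH i) ∧ (y', x) ∈ M.R1
  tgt : ∀ i < K, ∀ d p x, (w, d) ∈ M.R1 → (d, p) ∈ M.R1 → (p, x) ∈ M.R1 → Ty M x 1 →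
    ∃ m, (x, m) ∈ M.R1 ∧ Ty M m (tM i)

/-- the domain of the relational structure read off from a pointed model -/
def dm (M : SLLModel W) (w : W) (x : W) : Prop :=
  Ty M x 1 ∧ ∃ y, (w, y) ∈ M.R1 ∧ Ty M y (tH 0) ∧ (y, x) ∈ M.R1

def pt (M : SLLModel W) (d : W) (t : ℕ) (x : W) : Prop :=
  ∃ p, (d, p) ∈ M.R1 ∧ Ty M p t ∧ (p, x) ∈ M.R1

/-- the relations read off from a pointed model -/
def rl (M : SLLModel W) (w : W) (P : ℕ) (a b c : W) : Prop :=
  ∃ d, (w, d) ∈ M.R1 ∧ Ty M d (tF P) ∧ pt M d 2 a ∧ pt M d 3 b ∧ pt M d 4 c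

/-- `N` is `M` with the points `ρ i`, `i ∈ I`, marked -/
structure Marked (M : SLLModel W) (w : W) (I : List ℕ) (ρ y m : ℕ → W)
    (N : SLLModel W) : Prop where
  V : N.V = M.V
  R2 : N.R2 = M.R2
  R1 : ∀ e, e ∈ N.R1 ↔ e ∈ M.R1 ∧ ∀ i ∈ I, e ≠ (ρ i, m i) ∧ e ≠ (w, y i)
  dom : ∀ i ∈ I, dm M w (ρ i)
  tm : ∀ i ∈ I, Ty M (m i) (tM i)
  ty : ∀ i ∈ I, Ty M (y i) (tH i)
  em : ∀ i ∈ I, (ρ i, m i) ∈ M.R1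

theorem Marked.Ty {M : SLLModel W} {w : W} {I : List ℕ} {ρ y m : ℕ → W} {N : SLLModel W}
    (h : Marked M w I ρ y m N) (x : W) (n : ℕ) : Ty N x n ↔ Ty M x n := by
  simp [SLLUndec.Ty, h.V]

theorem Ty.ne {M : SLLModel W} {x y : W} {n m : ℕ} (h1 : Ty M x n) (h2 : Ty M y m)
    (h : n ≠ m) : x ≠ y := by
  rintro rfl; exact h (h1.inj h2)

theorem posF_iff {K : ℕ} {M : SLLModel W} {w : W} (hK : 0 < K) (B : Base K M w)
    {I : List ℕ} (hI : ∀ i ∈ I, i < K)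
    {ρ y m : ℕ → W} {N : SLLModel W} (h : Marked M w I ρ y m N) (P : ℕ) (d : W)
    (hwd : (w, d) ∈ M.R1) (hd : Ty M d (tF P)) (t : ℕ) (ht : t = 2 ∨ t = 3 ∨ t = 4)
    (a : ℕ) (ha : a ∈ I) (hist : List W) :
    Sat N (posF t a) d hist ↔ pt M d t (ρ a) := by
  have hdp : ∀ p, (d, p) ∈ N.R1 ↔ (d, p) ∈ M.R1 := by
    intro p
    rw [h.R1]
    refine ⟨fun q => q.1, fun q => ⟨q, fun i hi => ⟨?_, ?_⟩⟩⟩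
    · intro e
      exact (hd.ne (h.dom i hi).1 (by unfold tF; omega)) (congrArg Prod.fst e)
    · intro e
      exact (hd.ne B.root (by unfold tF; omega)) (congrArg Prod.fst e)
  have hpx : ∀ p x, Ty M p t → ((p, x) ∈ N.R1 ↔ (p, x) ∈ M.R1) := by
    intro p x hp
    rw [h.R1]
    refine ⟨fun q => q.1, fun q => ⟨q, fun i hi => ⟨?_, ?_⟩⟩⟩
    · intro e
      exact (hp.ne (h.dom i hi).1 (by omega)) (congrArg Prod.fst e)
    · intro e
      exact (hp.ne B.root (by omega)) (congrArg Prod.fst e)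
  simp only [posF, Sat, sat_T, h.Ty, pt, hdp]
  refine exists_congr fun p => and_congr_right fun hp1 => and_congr_right fun hp2 => ?_
  simp only [hpx p _ hp2]
  constructor
  · rintro ⟨x, hx1, hx2, hx3⟩
    obtain ⟨m', hm1, hm2⟩ := B.tgt a (hI a ha) d p x hwd hp1 hx1 hx2
    have : (x, m') ∉ N.R1 := fun q => hx3 ⟨m', q, hm2⟩
    rw [h.R1] at this
    push Not at this
    obtain ⟨i, hi, hh⟩ := this hm1
    by_cases he : (x, m') = (ρ i, m i)
    · have h1 : x = ρ i := congrArg Prod.fst he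
      have h2 : m' = m i := congrArg Prod.snd he
      rw [h2] at hm2
      have := hm2.inj (h.tm i hi)
      have : a = i := by simp [tM] at this; exact this
      rw [this, ← h1]; exact hx1
    · have h1 : x = w := congrArg Prod.fst (hh he)
      exact absurd h1 (hx2.ne B.root (by omega))
  · intro hx
    refine ⟨ρ a, hx, (h.dom a ha).1, ?_⟩
    rintro ⟨m', hm1, hm2⟩
    obtain ⟨h1, y', hy1, hy2, hy3⟩ := h.dom a ha
    obtain ⟨_, m₀, _, _, _, hu⟩ := B.mrk a (hI a ha) 0 hK y' (ρ a) hy1 hy2 hy3 h1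
    rw [h.R1] at hm1
    have e1 := hu m' hm1.1 hm2
    have e2 := hu (m a) (h.em a ha) (h.tm a ha)
    exact (hm1.2 a ha).1 (by rw [e1, e2])

theorem tr_iff {K : ℕ} {M : SLLModel W} {w : W} (hK : 0 < K) (B : Base K M w) (φ : FO) :
    ∀ (I : List ℕ) (_ : ∀ i ∈ I, i < K) (_ : WF K I φ) (ρ y m : ℕ → W) (N : SLLModel W)
      (_ : Marked M w I ρ y m N),
      Sat N (tr φ) w [] ↔ FSat (dm M w) (rl M w) φ ρ := by
  induction φ with
  | rel P a b c =>
    intro I hI hwf ρ y m N h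
    obtain ⟨ha, hb, hc⟩ := hwf
    simp only [tr, Sat, sat_T, h.Ty, FSat, rl]
    refine exists_congr fun d => ?_
    constructor
    · rintro ⟨h1, h2, h3⟩
      have h1' := ((h.R1 _).1 h1).1
      refine ⟨h1', h2, ?_⟩
      simpa only [posF_iff hK B hI h P d h1' h2 2 (by omega) _ ha,
        posF_iff hK B hI h P d h1' h2 3 (by omega) _ hb,
        posF_iff hK B hI h P d h1' h2 4 (by omega) _ hc] using h3
    · rintro ⟨h1, h2, h3⟩
      refine ⟨?_, h2, ?_⟩
      · rw [h.R1]
        refine ⟨h1, fun i hi => ⟨?_, ?_⟩⟩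
        · intro e
          exact (B.root.ne (h.dom i hi).1 (by omega)) (congrArg Prod.fst e)
        · intro e
          exact (h2.ne (h.ty i hi) (by unfold tF  tH; omega)) (congrArg Prod.snd e)
      · simpa only [posF_iff hK B hI h P d h1 h2 2 (by omega) _ ha,
          posF_iff hK B hI h P d h1 h2 3 (by omega) _ hb,
          posF_iff hK B hI h P d h1 h2 4 (by omega) _ hc] using h3
  | neg φ ih =>
    intro I hI hwf ρ y m N h
    simp only [tr, Sat, FSat, ih I hI hwf ρ y m N h]
  | and φ ψ ih1 ih2 =>
    intro I hI hwf ρ y m N h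
    simp only [tr, Sat, FSat, ih1 I hI hwf.1 ρ y m N h, ih2 I hI hwf.2 ρ y m N h]
  | all i φ ih =>
    intro I hI hwf ρ y m N h
    obtain ⟨hi, hiI, hwf⟩ := hwf
    have hI' : ∀ j ∈ i :: I, j < K := by
      intro j hj
      rcases List.mem_cons.1 hj with rfl | hj
      · exact hi
      · exact hI j hj
    have hne : ∀ j ∈ I, j ≠ i := fun j hj e => hiI (e ▸ hj)
    -- the successor state
    have next : ∀ y' x m', Ty M y' (tH i) → dm M w x → Ty M m' (tM i) → (x, m') ∈ M.R1 →
        Marked M w (i :: I) (Function.update ρ i x) (Function.update y i y')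
          (Function.update m i m') ((N.del (x, m')).del (w, y')) := by
      intro y' x m' hy' hx hm' hxm
      refine ⟨h.V, h.R2, ?_, ?_, ?_, ?_, ?_⟩
      · intro e
        have : e ∈ ((N.del (x, m')).del (w, y')).R1 ↔
            (e ∈ N.R1 ∧ e ≠ (x, m')) ∧ e ≠ (w, y') := Iff.rfl
        rw [this, h.R1]
        simp only [List.forall_mem_cons, Function.update_self]
        constructor
        · rintro ⟨⟨⟨h1, h2⟩, h3⟩, h4⟩
          refine ⟨h1, ⟨h3, h4⟩, fun j hj => ?_⟩
          simpa only [Function.update_of_ne (hne j hj)] using h2 j hj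
        · rintro ⟨h1, ⟨h3, h4⟩, h2⟩
          refine ⟨⟨⟨h1, fun j hj => ?_⟩, h3⟩, h4⟩
          simpa only [Function.update_of_ne (hne j hj)] using h2 j hj
      all_goals
        simp only [List.forall_mem_cons, Function.update_self]
        refine ⟨by assumption, fun j hj => ?_⟩
        simp only [Function.update_of_ne (hne j hj)]
      · exact h.dom j hj
      · exact h.tm j hj
      · exact h.ty j hj
      · exact h.em j hj
    have hwN : Ty N w 0 := (h.Ty _ _).2 B.root
    simp only [tr, sat_box, sat_imp, sat_T, FSat, h.Ty]
    constructor
    · intro hs x hx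
      obtain ⟨hx1, y0, hy1, hy2, hy3⟩ := hx
      obtain ⟨y', hy'1, hy'2, hy'3⟩ := B.hdl i hi 0 hK y0 x hy1 hy2 hy3 hx1
      have e1 : (w, y') ∈ N.R1 := by
        rw [h.R1]
        refine ⟨hy'1, fun j hj => ⟨?_, ?_⟩⟩
        · intro e
          exact (B.root.ne (h.dom j hj).1 (by omega)) (congrArg Prod.fst e)
        · intro e
          refine (hy'2.ne (h.ty j hj) ?_) (congrArg Prod.snd e)
          have := hne j hj
          unfold tH; omega
      have e2 : (y', x) ∈ N.R1 := by
        rw [h.R1]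
        refine ⟨hy'3, fun j hj => ⟨?_, ?_⟩⟩
        · intro e
          exact (hy'2.ne (h.dom j hj).1 (by unfold tH; omega)) (congrArg Prod.fst e)
        · intro e
          exact (hy'2.ne B.root (by unfold tH; omega)) (congrArg Prod.fst e)
      have := hs y' e1 hy'2 x e2 hx1
      rw [mark_iff N i i (tr φ) w y' x hwN ((h.Ty _ _).2 hy'2) ((h.Ty _ _).2 hx1)] at this
      obtain ⟨m', hm1, hm2, _, _, _, hs'⟩ := this
      exact (ih (i :: I) hI' hwf _ _ _ _ (next y' x m' hy'2 ⟨hx1, y0, hy1, hy2, hy3⟩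
        ((h.Ty _ _).1 hm2) ((h.R1 _).1 hm1).1)).1 hs'
    · intro hs y' e1 hy' x e2 hx1
      rw [mark_iff N i i (tr φ) w y' x hwN ((h.Ty _ _).2 hy') ((h.Ty _ _).2 hx1)]
      have e1' := ((h.R1 _).1 e1).1
      have e2' := ((h.R1 _).1 e2).1
      obtain ⟨hn, m', hm1, hm2, hm3, hm4⟩ := B.mrk i hi i hi y' x e1' hy' e2' hx1
      have hd : dm M w x := ⟨hx1, B.hdl 0 hK i hi y' x e1' hy' e2' hx1⟩
      refine ⟨m', ?_, (h.Ty _ _).2 hm2, by rw [h.R2]; exact hm3, by rw [h.R2]; exact hn, ?_, ?_⟩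
      · rw [h.R1]
        refine ⟨hm1, fun j hj => ⟨?_, ?_⟩⟩
        · intro e
          refine (hm2.ne (h.tm j hj) ?_) (congrArg Prod.snd e)
          have := hne j hj
          unfold tM; omega
        · intro e
          exact (hx1.ne B.root (by omega)) (congrArg Prod.fst e)
      · intro m'' q1 q2
        exact hm4 m'' ((h.R1 _).1 q1).1 ((h.Ty _ _).1 q2)
      · exact (ih (i :: I) hI' hwf _ _ _ _ (next y' x m' hy' hd hm2 hm1)).2 (hs x hd)

theorem tr_iff_closed {K : ℕ} {M : SLLModel W} {w : W} (hK : 0 < K) (B : Base K M w) (φ : FO)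
    (hwf : WF K [] φ) :
    Sat M (tr φ) w [] ↔ FSat (dm M w) (rl M w) φ (fun _ => w) :=
  tr_iff hK B φ [] (by simp) hwf (fun _ => w) (fun _ => w) (fun _ => w) M
    ⟨rfl, rfl, by simp, by simp, by simp, by simp, by simp⟩

def ax1 (i j : ℕ) : Form := box (imp (T (tH j)) (box (imp (T 1) (mark i top))))

def ax2 (i j : ℕ) : Form :=
  if i = j then top else box (imp (T (tH j)) (box (imp (T 1) (mark j
    (.dia ((T (tH i)).and (.dia ((T 1).and (.neg (.dia (T (tM j)))))))))))) 

def ax3 (i : ℕ) : Form := box (box (box (imp (T 1) (.dia (T (tM i))))))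

/-- the formula expressing `Base` -/
def baseF (K : ℕ) : Form :=
  (T 0).and
    ((conj ((List.range K).map fun i => conj ((List.range K).map fun j => ax1 i j))).and
    ((conj ((List.range K).map fun i => conj ((List.range K).map fun j => ax2 i j))).and
    (conj ((List.range K).map fun i => ax3 i))))

theorem baseF_iff (K : ℕ) (M : SLLModel W) (w : W) : Sat M (baseF K) w [] ↔ Base K M w := by
  simp only [baseF, ax1, ax2, ax3, Sat, sat_conj, List.forall_mem_map, List.mem_range, sat_T,
    sat_box, sat_imp]
  constructor
  · rintro ⟨h0, h1, h2, h3⟩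
    have hmk : ∀ i < K, ∀ j < K, ∀ y x, (w, y) ∈ M.R1 → Ty M y (tH j) → (y, x) ∈ M.R1 →
      Ty M x 1 → (w, y) ∉ M.R2 ∧ ∃ m, (x, m) ∈ M.R1 ∧ Ty M m (tM i) ∧ (x, m) ∉ M.R2 ∧
      ∀ m', (x, m') ∈ M.R1 → Ty M m' (tM i) → m' = m := by
      intro i hi j hj y x e1 hy e2 hx
      have := h1 i hi j hj y e1 hy x e2 hx
      rw [mark_iff M i j _ w y x h0 hy hx] at this
      obtain ⟨m, q1, q2, q3, q4, q5, _⟩ := this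
      exact ⟨q4, m, q1, q2, q3, q5⟩
    refine ⟨h0, hmk, ?_, ?_⟩
    · intro i hi j hj y x e1 hy e2 hx
      by_cases hij : i = j
      · subst hij
        exact ⟨y, e1, hy, e2⟩
      · have := h2 i hi j hj
        rw [if_neg hij] at this
        simp only [sat_box, sat_imp, sat_T] at this
        have := this y e1 hy x e2 hx
        rw [mark_iff M j j _ w y x h0 hy hx] at this
        obtain ⟨m, q1, q2, q3, q4, q5, q6⟩ := this
        simp only [Sat, sat_T, Ty_del] at q6
        obtain ⟨y', r1, r2, x', r3, r4, r5⟩ := q6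
        obtain ⟨_, m', s1, s2, _, _⟩ := hmk j hj i hi y' x' r1.1.1 r2 r3.1.1 r4
        have : x' = x := by
          by_contra hne
          refine r5 ⟨m', ⟨⟨s1, ?_⟩, ?_⟩, s2⟩
          · intro e
            exact hne (congrArg Prod.fst e)
          · intro e
            exact r4.ne h0 (by omega) (congrArg Prod.fst e)
        subst this
        exact ⟨y', r1.1.1, r2, r3.1.1⟩
    · intro i hi d p x e1 e2 e3 hx
      exact h3 i hi d e1 p e2 x e3 hx
  · intro B
    refine ⟨B.root, ?_, ?_, ?_⟩
    · intro i hi j hj y e1 hy x e2 hx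
      rw [mark_iff M i j _ w y x B.root hy hx]
      obtain ⟨q, m, q1, q2, q3, q4⟩ := B.mrk i hi j hj y x e1 hy e2 hx
      exact ⟨m, q1, q2, q3, q, q4, sat_top _ _ _⟩
    · intro i hi j hj
      by_cases hij : i = j
      · rw [if_pos hij]; exact sat_top _ _ _
      · rw [if_neg hij]
        simp only [sat_box, sat_imp, sat_T]
        intro y e1 hy x e2 hx
        rw [mark_iff M j j _ w y x B.root hy hx]
        obtain ⟨q, m, q1, q2, q3, q4⟩ := B.mrk j hj j hj y x e1 hy e2 hx
        refine ⟨m, q1, q2, q3, q, q4, ?_⟩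
        obtain ⟨y', r1, r2, r3⟩ := B.hdl i hi j hj y x e1 hy e2 hx
        simp only [Sat, sat_T, Ty_del]
        refine ⟨y', ⟨⟨r1, ?_⟩, ?_⟩, r2, x, ⟨⟨r3, ?_⟩, ?_⟩, hx, ?_⟩
        · intro e
          exact hx.ne B.root (by omega) (congrArg Prod.fst e).symm
        · intro e
          exact r2.ne hy (by unfold tH; omega) (congrArg Prod.snd e)
        · intro e
          exact r2.ne hx (by unfold tH; omega) (congrArg Prod.fst e)
        · intro e
          exact r2.ne B.root (by unfold tH; omega) (congrArg Prod.fst e)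
        · rintro ⟨m', ⟨⟨s1, s2⟩, _⟩, s3⟩
          exact s2 (by simp [q4 m' s1 s3])
    · intro i hi d e1 p e2 x e3 hx
      exact B.tgt i hi d p x e1 e2 e3 hx

end basics

/-! ### The model of a relational structure -/

/-- worlds of the model built from a relational structure on `X` -/
inductive Wd (X : Type) : Type
  | root : Wd X
  | el : X → Wd X
  | mk : ℕ → Wd X
  | hd : ℕ → X → Wd X
  | pos : ℕ → X → Wd X
  | fact : ℕ → X → X → X → Wd X

variable {X : Type}

def Wd.ty : Wd X → ℕ
  | .root => 0
  | .el _ => 1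
  | .pos t _ => if t = 3 then 3 else if t = 4 then 4 else 2
  | .mk i => tM i
  | .hd i _ => tH i
  | .fact P _ _ _ => tF P

inductive Wd.E (r : ℕ → X → X → X → Prop) : Wd X → Wd X → Prop
  | hd (i : ℕ) (x : X) : Wd.E r .root (.hd i x)
  | el (i : ℕ) (x : X) : Wd.E r (.hd i x) (.el x)
  | mk (i : ℕ) (x : X) : Wd.E r (.el x) (.mk i)
  | fact (P : ℕ) (a b c : X) : r P a b c → Wd.E r .root (.fact P a b c)
  | p2 (P : ℕ) (a b c : X) : Wd.E r (.fact P a b c) (.pos 2 a)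
  | p3 (P : ℕ) (a b c : X) : Wd.E r (.fact P a b c) (.pos 3 b)
  | p4 (P : ℕ) (a b c : X) : Wd.E r (.fact P a b c) (.pos 4 c)
  | pos (t : ℕ) (x : X) : Wd.E r (.pos t x) (.el x)

def stdM (r : ℕ → X → X → X → Prop) : SLLModel (Wd X) where
  R1 := {e | Wd.E r e.1 e.2}
  R2 := ∅
  V n := {x | x.ty = n}

theorem stdM_Ty (r : ℕ → X → X → X → Prop) (x : Wd X) (n : ℕ) :
    Ty (stdM r) x n ↔ x.ty = n := by
  constructor
  · intro h; exact h.2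
  · intro h
    refine ⟨fun j hj e => ?_, h⟩
    have : x.ty = j := e
    omega

theorem stdM_R1 (r : ℕ → X → X → X → Prop) (x y : Wd X) :
    (x, y) ∈ (stdM r).R1 ↔ Wd.E r x y := Iff.rfl

theorem ty_el {x : Wd X} (h : x.ty = 1) : ∃ a, x = .el a := by
  cases x
  case root =>
    simp only [Wd.ty, tM, tH, tF] at h
    omega
  case el a => exact ⟨a, rfl⟩
  case mk =>
    simp only [Wd.ty, tM, tH, tF] at h
    omega
  case hd =>
    simp only [Wd.ty, tM, tH, tF] at h
    omega
  case pos =>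
    simp only [Wd.ty, tM, tH, tF] at h
    split_ifs at h <;> omega
  case fact =>
    simp only [Wd.ty, tM, tH, tF] at h
    omega

theorem ty_hd {x : Wd X} {i : ℕ} (h : x.ty = tH i) : ∃ a, x = .hd i a := by
  cases x
  case root =>
    simp only [Wd.ty, tM, tH, tF] at h
    omega
  case el =>
    simp only [Wd.ty, tM, tH, tF] at h
    omega
  case mk =>
    simp only [Wd.ty, tM, tH, tF] at h
    omega
  case hd k a =>
    have : k = i := by simp only [Wd.ty, tM, tH, tF] at h; omega
    subst this; exact ⟨a, rfl⟩
  case pos =>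
    simp only [Wd.ty, tM, tH, tF] at h
    split_ifs at h <;> omega
  case fact =>
    simp only [Wd.ty, tM, tH, tF] at h
    omega

theorem ty_mk {x : Wd X} {i : ℕ} (h : x.ty = tM i) : x = .mk i := by
  cases x
  case root =>
    simp only [Wd.ty, tM, tH, tF] at h
    omega
  case el =>
    simp only [Wd.ty, tM, tH, tF] at h
    omega
  case mk k =>
    have : k = i := by simp only [Wd.ty, tM, tH, tF] at h; omega
    subst this; exact rfl
  case hd =>
    simp only [Wd.ty, tM, tH, tF] at h
    omega
  case pos =>
    simp only [Wd.ty, tM, tH, tF] at h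
    split_ifs at h <;> omega
  case fact =>
    simp only [Wd.ty, tM, tH, tF] at h
    omega

theorem ty_fact {x : Wd X} {i : ℕ} (h : x.ty = tF i) : ∃ a b c, x = .fact i a b c := by
  cases x
  case root =>
    simp only [Wd.ty, tM, tH, tF] at h
    omega
  case el =>
    simp only [Wd.ty, tM, tH, tF] at h
    omega
  case mk =>
    simp only [Wd.ty, tM, tH, tF] at h
    omega
  case hd =>
    simp only [Wd.ty, tM, tH, tF] at h
    omega
  case pos =>
    simp only [Wd.ty, tM, tH, tF] at h
    split_ifs at h <;> omega
  case fact k a b c =>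
    have : k = i := by simp only [Wd.ty, tM, tH, tF] at h; omega
    subst this; exact ⟨a, b, c, rfl⟩

theorem stdM_base (r : ℕ → X → X → X → Prop) (K : ℕ) : Base K (stdM r) (.root) := by
  refine ⟨by rw [stdM_Ty]; rfl, ?_, ?_, ?_⟩
  · intro i _ j _ y x _ _ _ hx
    rw [stdM_Ty] at hx
    obtain ⟨a, rfl⟩ := ty_el hx
    refine ⟨fun h => h, .mk i, Wd.E.mk i a, by rw [stdM_Ty]; rfl, fun h => h, ?_⟩
    intro m' _ h
    rw [stdM_Ty] at h
    exact ty_mk h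
  · intro i _ j _ y x _ _ _ hx
    rw [stdM_Ty] at hx
    obtain ⟨a, rfl⟩ := ty_el hx
    exact ⟨.hd i a, Wd.E.hd i a, by rw [stdM_Ty]; rfl, Wd.E.el i a⟩
  · intro i _ d p x _ _ _ hx
    rw [stdM_Ty] at hx
    obtain ⟨a, rfl⟩ := ty_el hx
    exact ⟨.mk i, Wd.E.mk i a, by rw [stdM_Ty]; rfl⟩

theorem stdM_dm (r : ℕ → X → X → X → Prop) (x : Wd X) :
    dm (stdM r) .root x ↔ ∃ a, x = .el a := by
  constructor
  · rintro ⟨h, _⟩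
    rw [stdM_Ty] at h
    exact ty_el h
  · rintro ⟨a, rfl⟩
    exact ⟨by rw [stdM_Ty]; rfl, .hd 0 a, Wd.E.hd 0 a, by rw [stdM_Ty]; rfl, Wd.E.el 0 a⟩

theorem stdM_rl (r : ℕ → X → X → X → Prop) (P : ℕ) (a b c : X) :
    rl (stdM r) .root P (.el a) (.el b) (.el c) ↔ r P a b c := by
  constructor
  · rintro ⟨d, h1, h2, ⟨p, p1, p2, p3⟩, ⟨q, q1, q2, q3⟩, ⟨s, s1, s2, s3⟩⟩
    rw [stdM_Ty] at h2 p2 q2 s2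
    obtain ⟨a', b', c', rfl⟩ := ty_fact h2
    rw [stdM_R1] at *
    cases h1 with
    | fact _ _ _ _ hr =>
    cases p1 <;> simp [Wd.ty] at p2
    cases q1 <;> simp [Wd.ty] at q2
    cases s1 <;> simp [Wd.ty] at s2
    cases p3; cases q3; cases s3
    exact hr
  · intro h
    refine ⟨.fact P a b c, Wd.E.fact P a b c h, by rw [stdM_Ty]; rfl,
      ⟨.pos 2 a, Wd.E.p2 P a b c, by rw [stdM_Ty]; rfl, Wd.E.pos 2 a⟩,
      ⟨.pos 3 b, Wd.E.p3 P a b c, by rw [stdM_Ty]; rfl, Wd.E.pos 3 b⟩,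
      ⟨.pos 4 c, Wd.E.p4 P a b c, by rw [stdM_Ty]; rfl, Wd.E.pos 4 c⟩⟩

theorem stdM_FSat (r : ℕ → X → X → X → Prop) (φ : FO) : ∀ (ρ : ℕ → X),
    FSat (dm (stdM r) .root) (rl (stdM r) .root) φ (fun i => .el (ρ i)) ↔
      FSat (fun _ => True) r φ ρ := by
  induction φ with
  | rel P a b c => intro ρ; exact stdM_rl r P _ _ _
  | neg φ ih => intro ρ; simp only [FSat, ih]
  | and φ ψ ih1 ih2 => intro ρ; simp only [FSat, ih1, ih2]
  | all i φ ih =>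
    intro ρ
    have key : ∀ a, Function.update (fun j => Wd.el (ρ j)) i (Wd.el a) =
        fun j => Wd.el (Function.update ρ i a j) := by
      intro a
      funext j
      by_cases h : j = i
      · subst h; simp
      · simp [Function.update_of_ne h]
    simp only [FSat, stdM_dm]
    constructor
    · intro h a _
      rw [← ih, ← key]
      exact h _ ⟨a, rfl⟩
    · rintro h _ ⟨a, rfl⟩
      rw [key, ih]
      exact h a trivial

/-- truth of closed formulas does not depend on the assignment -/
theorem FSat_congr (dom : X → Prop) (r : ℕ → X → X → X → Prop) (K : ℕ) (φ : FO) :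
    ∀ (I : List ℕ) (_ : WF K I φ) (ρ ρ' : ℕ → X) (_ : ∀ i ∈ I, ρ i = ρ' i),
      FSat dom r φ ρ ↔ FSat dom r φ ρ' := by
  induction φ with
  | rel P a b c =>
    rintro I ⟨ha, hb, hc⟩ ρ ρ' h
    simp only [FSat, h a ha, h b hb, h c hc]
  | neg φ ih => intro I hw ρ ρ' h; simp only [FSat, ih I hw ρ ρ' h]
  | and φ ψ ih1 ih2 =>
    intro I hw ρ ρ' h; simp only [FSat, ih1 I hw.1 ρ ρ' h, ih2 I hw.2 ρ ρ' h]
  | all i φ ih =>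
    intro I hw ρ ρ' h
    simp only [FSat]
    refine forall_congr' fun x => imp_congr_right fun _ => ih (i :: I) hw.2.2 _ _ ?_
    intro j hj
    by_cases hji : j = i
    · subst hji; simp
    · simp only [Function.update_of_ne hji]
      exact h j ((List.mem_cons.1 hj).resolve_left hji)

theorem stdM_tr (r : ℕ → X → X → X → Prop) {K : ℕ} (hK : 0 < K) (φ : FO)
    (hwf : WF K [] φ) (ρ : ℕ → X) :
    Sat (stdM r) (tr φ) .root [] ↔ FSat (fun _ => True) r φ ρ := by
  rw [tr_iff_closed hK (stdM_base r K) φ hwf, ← stdM_FSat]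
  exact FSat_congr _ _ K φ [] hwf _ _ (by simp)

/-! ### The Horn theory of a code -/

open Turing.ToPartrec (Code)

/-- an injective numbering of codes -/
def enc : Code → ℕ
  | .zero' => Nat.pair 0 0
  | .succ => Nat.pair 1 0
  | .tail => Nat.pair 2 0
  | .cons f g => Nat.pair 3 (Nat.pair (enc f) (enc g))
  | .comp f g => Nat.pair 4 (Nat.pair (enc f) (enc g))
  | .case f g => Nat.pair 5 (Nat.pair (enc f) (enc g))
  | .fix f => Nat.pair 6 (enc f)

theorem enc_inj : ∀ c d : Code, enc c = enc d → c = d := by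
  intro c
  induction c with
  | zero' => intro d h; cases d <;> simp [enc, Nat.pair_eq_pair] at h ⊢
  | succ => intro d h; cases d <;> simp [enc, Nat.pair_eq_pair] at h ⊢
  | tail => intro d h; cases d <;> simp [enc, Nat.pair_eq_pair] at h ⊢
  | cons f g ih1 ih2 =>
    intro d h; cases d <;> simp [enc, Nat.pair_eq_pair] at h ⊢
    exact ⟨ih1 _ h.1, ih2 _ h.2⟩
  | comp f g ih1 ih2 =>
    intro d h; cases d <;> simp [enc, Nat.pair_eq_pair] at h ⊢
    exact ⟨ih1 _ h.1, ih2 _ h.2⟩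
  | case f g ih1 ih2 =>
    intro d h; cases d <;> simp [enc, Nat.pair_eq_pair] at h ⊢
    exact ⟨ih1 _ h.1, ih2 _ h.2⟩
  | fix f ih =>
    intro d h; cases d <;> simp [enc, Nat.pair_eq_pair] at h ⊢
    exact ih _ h

namespace FO
def imp (φ ψ : FO) : FO := .neg (.and φ (.neg ψ))
def ex (i : ℕ) (φ : FO) : FO := .neg (.all i (.neg φ))
def pNil (a : ℕ) : FO := .rel 1 a a a
def pZ (a b : ℕ) : FO := .rel 3 a b b
def pS (a b : ℕ) : FO := .rel 5 a b b
def pC (a b c : ℕ) : FO := .rel 7 a b c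
def pT (a b : ℕ) : FO := .rel 9 a b b
def pE (c : Code) (a b : ℕ) : FO := .rel (11 + 2 * enc c) a b b
def pN (j a : ℕ) : FO := .rel (2 * j) a a a
end FO

theorem FSat_imp (dom : X → Prop) (r : ℕ → X → X → X → Prop) (φ ψ : FO) (ρ : ℕ → X) :
    FSat dom r (.imp φ ψ) ρ ↔ (FSat dom r φ ρ → FSat dom r ψ ρ) := by
  simp [FO.imp, FSat]

theorem FSat_ex (dom : X → Prop) (r : ℕ → X → X → X → Prop) (φ : FO) (i : ℕ) (ρ : ℕ → X) :
    FSat dom r (.ex i φ) ρ ↔ ∃ x, dom x ∧ FSat dom r φ (Function.update ρ i x) := by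
  simp [FO.ex, FSat]

open FO in
/-- basic axioms -/
def thB : List FO :=
  [ex 0 (pNil 0),
   all 0 (ex 1 (pZ 1 0)),
   all 0 (all 1 (imp (pZ 0 1) (ex 2 (pS 2 0)))),
   all 0 (all 1 (imp (pS 0 1) (ex 2 (pS 2 0)))),
   all 0 (all 1 (all 2 (imp (pNil 0) (imp (pZ 2 1) (pC 0 1 2))))),
   all 0 (all 1 (all 2 (all 3 (imp (pZ 0 3) (imp (pZ 2 1) (pC 0 1 2)))))),
   all 0 (all 1 (all 2 (all 3 (all 4 (imp (pS 0 1) (imp (pC 1 2 3) (imp (pS 4 3) (pC 0 2 4)))))))),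
   all 0 (imp (pNil 0) (pT 0 0)),
   all 0 (all 1 (imp (pZ 0 1) (pT 0 1))),
   all 0 (all 1 (all 2 (imp (pS 0 1) (imp (pT 1 2) (pT 0 2))))),
   all 0 (all 1 (imp (pNil 0) (imp (pZ 1 0) (pN 0 1))))]

open FO in
/-- the axioms for a code -/
def thC : Code → List FO
  | .zero' => [all 0 (all 1 (imp (pZ 1 0) (pE .zero' 0 1)))]
  | .succ => [all 0 (all 1 (all 2 (all 3 (imp (pNil 1) (imp (pC 0 1 2) (imp (pS 3 2)
      (pE .succ 0 3)))))))]
  | .tail => [all 0 (all 1 (imp (pT 0 1) (pE .tail 0 1)))]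
  | .cons f g => all 0 (all 1 (all 2 (all 3 (imp (pE f 0 1) (imp (pE g 0 2) (imp (pC 1 2 3)
      (pE (.cons f g) 0 3))))))) :: (thC f ++ thC g)
  | .comp f g => all 0 (all 1 (all 2 (imp (pE g 0 1) (imp (pE f 1 2)
      (pE (.comp f g) 0 2))))) :: (thC f ++ thC g)
  | .case f g => all 0 (all 1 (imp (pNil 0) (imp (pE f 0 1) (pE (.case f g) 0 1)))) ::
      all 0 (all 1 (all 2 (imp (pZ 0 1) (imp (pE f 1 2) (pE (.case f g) 0 2))))) ::
      all 0 (all 1 (all 2 (imp (pS 0 1) (imp (pE g 1 2) (pE (.case f g) 0 2))))) ::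
      (thC f ++ thC g)
  | .fix f => all 0 (all 1 (imp (pE f 0 1) (imp (pNil 1) (pE (.fix f) 0 1)))) ::
      all 0 (all 1 (all 2 (imp (pE f 0 1) (imp (pZ 1 2) (pE (.fix f) 0 2))))) ::
      all 0 (all 1 (all 2 (all 3 (all 4 (imp (pE f 0 1) (imp (pS 1 2) (imp (pT 1 3)
        (imp (pE (.fix f) 3 4) (pE (.fix f) 0 4))))))))) :: thC f

open FO in
def numAx (j : ℕ) : FO := all 0 (all 1 (imp (pN j 0) (imp (pS 1 0) (pN (j + 1) 1))))

open FO in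
def goalAx (c : Code) (k : ℕ) : FO := all 0 (all 1 (imp (pN k 0) (neg (pE c 0 1))))

theorem wf_thB : ∀ φ ∈ thB, WF 5 [] φ := by
  simp [thB, WF, FO.imp, FO.ex, FO.pNil, FO.pZ, FO.pS, FO.pC, FO.pT, FO.pN]

theorem wf_thC (c : Code) : ∀ φ ∈ thC c, WF 5 [] φ := by
  induction c with
  | zero' => simp [thC, WF, FO.imp, FO.ex, FO.pNil, FO.pZ, FO.pS, FO.pC, FO.pT, FO.pE]
  | succ => simp [thC, WF, FO.imp, FO.ex, FO.pNil, FO.pZ, FO.pS, FO.pC, FO.pT, FO.pE]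
  | tail => simp [thC, WF, FO.imp, FO.ex, FO.pNil, FO.pZ, FO.pS, FO.pC, FO.pT, FO.pE]
  | fix f ih =>
    simp only [thC, List.forall_mem_cons]
    refine ⟨?_, ?_, ?_, ih⟩ <;>
      simp [WF, FO.imp, FO.ex, FO.pNil, FO.pZ, FO.pS, FO.pC, FO.pT, FO.pE]
  | case f g ih1 ih2 =>
    simp only [thC, List.forall_mem_cons, List.forall_mem_append]
    refine ⟨?_, ?_, ?_, ih1, ih2⟩ <;>
      simp [WF, FO.imp, FO.ex, FO.pNil, FO.pZ, FO.pS, FO.pC, FO.pT, FO.pE]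
  | cons f g ih1 ih2 =>
    simp only [thC, List.forall_mem_cons, List.forall_mem_append]
    refine ⟨?_, ih1, ih2⟩
    simp [WF, FO.imp, FO.ex, FO.pNil, FO.pZ, FO.pS, FO.pC, FO.pT, FO.pE]
  | comp f g ih1 ih2 =>
    simp only [thC, List.forall_mem_cons, List.forall_mem_append]
    refine ⟨?_, ih1, ih2⟩
    simp [WF, FO.imp, FO.ex, FO.pNil, FO.pZ, FO.pS, FO.pC, FO.pT, FO.pE]

theorem wf_numAx (j : ℕ) : WF 5 [] (numAx j) := by
  simp [numAx, WF, FO.imp, FO.pS, FO.pN]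

theorem wf_goalAx (c : Code) (j : ℕ) : WF 5 [] (goalAx c j) := by
  simp [goalAx, WF, FO.imp, FO.pE, FO.pN]

/-! ### Membership in evaluations -/

theorem mem_zero' (v w : List ℕ) : w ∈ Code.zero'.eval v ↔ w = 0 :: v := by
  simp [Part.pure_eq_some]

theorem mem_succ (v w : List ℕ) : w ∈ Code.succ.eval v ↔ w = [v.headI + 1] := by
  simp [Part.pure_eq_some]

theorem mem_tail (v w : List ℕ) : w ∈ Code.tail.eval v ↔ w = v.tail := by
  simp [Part.pure_eq_some]

theorem mem_cons (f g : Code) (v w : List ℕ) : w ∈ (Code.cons f g).eval v ↔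
    ∃ a ∈ f.eval v, ∃ b ∈ g.eval v, w = a.headI :: b := by
  simp [Part.pure_eq_some, Part.bind_eq_bind]

theorem mem_comp (f g : Code) (v w : List ℕ) : w ∈ (Code.comp f g).eval v ↔
    ∃ a ∈ g.eval v, w ∈ f.eval a := by
  rw [Code.comp_eval]; exact Part.mem_bind_iff

theorem mem_case_nil (f g : Code) (w : List ℕ) : w ∈ (Code.case f g).eval [] ↔
    w ∈ f.eval [] := by
  simp

theorem mem_case_zero (f g : Code) (v w : List ℕ) : w ∈ (Code.case f g).eval (0 :: v) ↔
    w ∈ f.eval v := by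
  simp

theorem mem_case_succ (f g : Code) (n : ℕ) (v w : List ℕ) :
    w ∈ (Code.case f g).eval ((n + 1) :: v) ↔ w ∈ g.eval (n :: v) := by
  simp

theorem mem_fix (f : Code) (v w : List ℕ) : w ∈ (Code.fix f).eval v ↔
    ∃ u ∈ f.eval v, (u.headI = 0 ∧ w = u.tail) ∨
      (u.headI ≠ 0 ∧ w ∈ (Code.fix f).eval u.tail) := by
  rw [Code.fix_eval]
  refine PFun.mem_fix_iff.trans ?_
  simp only [Part.mem_map_iff]
  constructor
  · rintro (⟨u, hu, h⟩ | ⟨a', ⟨u, hu, h⟩, h'⟩)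
    · split_ifs at h with h0
      exact ⟨u, hu, Or.inl ⟨h0, by simpa using h.symm⟩⟩
    · split_ifs at h with h0
      simp only [Sum.inr.injEq] at h
      subst h
      exact ⟨u, hu, Or.inr ⟨h0, h'⟩⟩
  · rintro ⟨u, hu, (⟨h0, h⟩ | ⟨h0, h⟩)⟩
    · exact Or.inl ⟨u, hu, by simp [h0, h]⟩
    · exact Or.inr ⟨_, ⟨u, hu, by simp [h0]⟩, h⟩

theorem fix_ind (f : Code) (w : List ℕ) (C : List ℕ → Prop)
    (hb : ∀ v u, u ∈ f.eval v → u.headI = 0 → w = u.tail → C v)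
    (hs : ∀ v u, u ∈ f.eval v → u.headI ≠ 0 → C u.tail → C v) (v : List ℕ)
    (h : w ∈ (Code.fix f).eval v) : C v := by
  rw [Code.fix_eval] at h
  refine PFun.fixInduction' (C := C) h ?_ ?_
  · intro a ha
    obtain ⟨u, hu, h⟩ := (Part.mem_map_iff _).1 ha
    split_ifs at h with h0
    exact hb a u hu h0 (by simpa using h.symm)
  · intro a b _ ha ih
    obtain ⟨u, hu, h⟩ := (Part.mem_map_iff _).1 ha
    split_ifs at h with h0
    simp only [Sum.inr.injEq] at h
    subst h
    exact hs a u hu h0 ih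

/-! ### The standard structure on lists -/

def rS (P : ℕ) (a b c : List ℕ) : Prop :=
  (P = 1 ∧ a = []) ∨ (P = 3 ∧ a = 0 :: b) ∨ (P = 5 ∧ ∃ n l, b = n :: l ∧ a = (n + 1) :: l) ∨
  (P = 7 ∧ c = a.headI :: b) ∨ (P = 9 ∧ b = a.tail) ∨
  (∃ d : Code, P = 11 + 2 * enc d ∧ b ∈ d.eval a) ∨ (∃ j, P = 2 * j ∧ a = [j])

theorem rS1 (a b c : List ℕ) : rS 1 a b c ↔ a = [] := by
  have h1 : ∀ d, ¬ (1 = 11 + 2 * enc d) := by intro d; omega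
  have h2 : ∀ j, ¬ (1 = 2 * j) := by intro d; omega
  simp [rS, h1, h2]

theorem rS3 (a b c : List ℕ) : rS 3 a b c ↔ a = 0 :: b := by
  have h1 : ∀ d, ¬ (3 = 11 + 2 * enc d) := by intro d; omega
  have h2 : ∀ j, ¬ (3 = 2 * j) := by intro d; omega
  simp [rS, h1, h2]

theorem rS5 (a b c : List ℕ) : rS 5 a b c ↔ ∃ n l, b = n :: l ∧ a = (n + 1) :: l := by
  have h1 : ∀ d, ¬ (5 = 11 + 2 * enc d) := by intro d; omega
  have h2 : ∀ j, ¬ (5 = 2 * j) := by intro d; omega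
  simp [rS, h1, h2]

theorem rS7 (a b c : List ℕ) : rS 7 a b c ↔ c = a.headI :: b := by
  have h1 : ∀ d, ¬ (7 = 11 + 2 * enc d) := by intro d; omega
  have h2 : ∀ j, ¬ (7 = 2 * j) := by intro d; omega
  simp [rS, h1, h2]

theorem rS9 (a b c : List ℕ) : rS 9 a b c ↔ b = a.tail := by
  have h1 : ∀ d, ¬ (9 = 11 + 2 * enc d) := by intro d; omega
  have h2 : ∀ j, ¬ (9 = 2 * j) := by intro d; omega
  simp [rS, h1, h2]

theorem rSE (d : Code) (a b c : List ℕ) : rS (11 + 2 * enc d) a b c ↔ b ∈ d.eval a := by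
  constructor
  · rintro (⟨h, _⟩ | ⟨h, _⟩ | ⟨h, _⟩ | ⟨h, _⟩ | ⟨h, _⟩ | ⟨d', h, h'⟩ | ⟨j, h, _⟩)
    · omega
    · omega
    · omega
    · omega
    · omega
    · have : d = d' := enc_inj _ _ (by omega)
      rw [this]; exact h'
    · omega
  · intro h
    exact Or.inr (Or.inr (Or.inr (Or.inr (Or.inr (Or.inl ⟨d, rfl, h⟩)))))

theorem rSN (j : ℕ) (a b c : List ℕ) : rS (2 * j) a b c ↔ a = [j] := by
  constructor
  · rintro (⟨h, _⟩ | ⟨h, _⟩ | ⟨h, _⟩ | ⟨h, _⟩ | ⟨h, _⟩ | ⟨d', h, h'⟩ | ⟨i, h, h'⟩)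
    · omega
    · omega
    · omega
    · omega
    · omega
    · omega
    · have : j = i := by omega
      rw [this]; exact h'
  · intro h
    exact Or.inr (Or.inr (Or.inr (Or.inr (Or.inr (Or.inr ⟨j, rfl, h⟩)))))

theorem std_thB (ρ : ℕ → List ℕ) : ∀ φ ∈ thB, FSat (fun _ => True) rS φ ρ := by
  have h0 : ∀ a b c : List ℕ, rS 0 a b c ↔ a = [0] := fun a b c => rSN 0 a b c
  simp only [thB, List.forall_mem_cons, FSat, FSat_imp, FSat_ex, FO.pNil, FO.pZ, FO.pS, FO.pC,
    FO.pT, FO.pN, rS1, rS3, rS5, rS7, rS9, h0, mul_zero, Function.update_self, ne_eq,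
    OfNat.ofNat_ne_zero, OfNat.zero_ne_ofNat, OfNat.ofNat_ne_one,
    OfNat.one_ne_ofNat, Nat.reduceEqDiff, zero_ne_one, one_ne_zero, not_false_eq_true,
    Function.update_of_ne, forall_const, true_and]
  refine ⟨⟨_, rfl⟩, fun x => ⟨_, rfl⟩, ?_, ?_, ?_, ?_, ?_, ?_, ?_, ?_, ?_, by simp⟩
  · rintro _ x rfl; exact ⟨_, _, _, rfl, rfl⟩
  · rintro _ _ ⟨n, l, rfl, rfl⟩; exact ⟨_, _, _, rfl, rfl⟩
  · rintro _ b _ rfl rfl; rfl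
  · rintro _ b _ l rfl rfl; rfl
  · rintro _ _ b _ _ ⟨n, l, rfl, rfl⟩ rfl ⟨n', l', h, rfl⟩
    simp at h
    obtain ⟨rfl, rfl⟩ := h
    rfl
  · rintro _ rfl; rfl
  · rintro _ _ rfl; rfl
  · rintro _ _ _ ⟨n, l, rfl, rfl⟩ rfl; rfl
  · rintro _ _ rfl rfl; rfl

theorem std_thC (ρ : ℕ → List ℕ) (c : Code) : ∀ φ ∈ thC c, FSat (fun _ => True) rS φ ρ := by
  induction c with
  | zero' =>
    simp [thC, FSat, FSat_imp, FO.pZ, FO.pE, rS3, rSE, mem_zero', -Code.zero'_eval]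
  | succ =>
    simp [thC, FSat, FSat_imp, FO.pNil, FO.pC, FO.pS, FO.pE, rS1, rS5, rS7, rSE, mem_succ,
      -Code.succ_eval]
    rintro a b c d rfl rfl n l h rfl
    simp at h
    simp [h]
  | tail =>
    simp [thC, FSat, FSat_imp, FO.pT, FO.pE, rS9, rSE, mem_tail, -Code.tail_eval]
  | cons f g ih1 ih2 =>
    simp only [thC, List.forall_mem_cons, List.forall_mem_append]
    refine ⟨?_, ih1, ih2⟩
    simp [FSat, FSat_imp, FO.pC, FO.pE, rS7, rSE, mem_cons, -Code.cons_eval]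
    rintro v a b r h1 h2 rfl
    exact ⟨a, h1, b, h2, rfl⟩
  | comp f g ih1 ih2 =>
    simp only [thC, List.forall_mem_cons, List.forall_mem_append]
    refine ⟨?_, ih1, ih2⟩
    simp [FSat, FSat_imp, FO.pE, rSE, mem_comp, -Code.comp_eval]
    intro v a b h1 h2
    exact ⟨a, h1, h2⟩
  | case f g ih1 ih2 =>
    simp only [thC, List.forall_mem_cons, List.forall_mem_append]
    refine ⟨?_, ?_, ?_, ih1, ih2⟩ <;>
      simp [FSat, FSat_imp, FO.pE, FO.pNil, FO.pZ, FO.pS, rS1, rS3, rS5, rSE, -Code.case_eval]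
    · rintro _ b rfl h
      exact (mem_case_nil f g b).2 h
    · rintro _ b c rfl h
      exact (mem_case_zero f g b c).2 h
    · rintro _ _ c n l rfl rfl h
      exact (mem_case_succ f g n l c).2 h
  | fix f ih =>
    simp only [thC, List.forall_mem_cons]
    refine ⟨?_, ?_, ?_, ih⟩ <;>
      simp [FSat, FSat_imp, FO.pE, FO.pNil, FO.pZ, FO.pS, FO.pT, rS1, rS3, rS5, rS9, rSE,
        -Code.fix_eval]
    · rintro v _ h rfl
      exact (mem_fix f v _).2 ⟨_, h, Or.inl ⟨rfl, rfl⟩⟩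
    · rintro v _ w h rfl
      exact (mem_fix f v _).2 ⟨_, h, Or.inl ⟨rfl, rfl⟩⟩
    · rintro v _ _ _ w h n l rfl rfl rfl h'
      exact (mem_fix f v _).2 ⟨_, h, Or.inr ⟨by simp, h'⟩⟩

theorem std_numAx (ρ : ℕ → List ℕ) (j : ℕ) : FSat (fun _ => True) rS (numAx j) ρ := by
  simp only [numAx, FSat, FSat_imp, FO.pN, FO.pS, rSN, rS5]
  simp
  rintro _ _ rfl n l h rfl
  simp at h
  simp [h]

theorem std_goalAx (ρ : ℕ → List ℕ) (c : Code) (k : ℕ) (h : ¬ (c.eval [k]).Dom) :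
    FSat (fun _ => True) rS (goalAx c k) ρ := by
  simp only [goalAx, FSat, FSat_imp, FO.pN, FO.pE, rSN, rSE]
  simp
  rintro _ b rfl hb
  exact h (Part.dom_iff_mem.2 ⟨b, hb⟩)

/-! ### Soundness -/

section sound
variable {dom : X → Prop} {r : ℕ → X → X → X → Prop}

/-- `Rep dom r l x`: the point `x` represents the list `l` -/
inductive Rep (dom : X → Prop) (r : ℕ → X → X → X → Prop) : List ℕ → X → Prop
  | nil (x : X) : dom x → r 1 x x x → Rep dom r [] x
  | zero (l : List ℕ) (x y : X) : dom x → r 3 x y y → Rep dom r l y → Rep dom r (0 :: l) x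
  | succ (n : ℕ) (l : List ℕ) (x y : X) : dom x → r 5 x y y → Rep dom r (n :: l) y →
      Rep dom r ((n + 1) :: l) x

theorem Rep.inD {l : List ℕ} {x : X} (h : Rep dom r l x) : dom x := by
  cases h <;> assumption

structure ThB (dom : X → Prop) (r : ℕ → X → X → X → Prop) : Prop where
  nil : ∃ x, dom x ∧ r 1 x x x
  zero : ∀ y, dom y → ∃ x, dom x ∧ r 3 x y y
  succ1 : ∀ y, dom y → ∀ z, dom z → r 3 y z z → ∃ x, dom x ∧ r 5 x y y
  succ2 : ∀ y, dom y → ∀ z, dom z → r 5 y z z → ∃ x, dom x ∧ r 5 x y y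
  c1 : ∀ a, dom a → ∀ b, dom b → ∀ c, dom c → r 1 a a a → r 3 c b b → r 7 a b c
  c2 : ∀ a, dom a → ∀ b, dom b → ∀ c, dom c → ∀ d, dom d → r 3 a d d → r 3 c b b → r 7 a b c
  c3 : ∀ a', dom a' → ∀ a, dom a → ∀ b, dom b → ∀ c, dom c → ∀ c', dom c' →
    r 5 a' a a → r 7 a b c → r 5 c' c c → r 7 a' b c'
  t1 : ∀ a, dom a → r 1 a a a → r 9 a a a
  t2 : ∀ a, dom a → ∀ b, dom b → r 3 a b b → r 9 a b b
  t3 : ∀ a', dom a' → ∀ a, dom a → ∀ b, dom b → r 5 a' a a → r 9 a b b → r 9 a' b b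
  n0 : ∀ a, dom a → ∀ b, dom b → r 1 a a a → r 3 b a a → r 0 b b b

theorem ThB_of {ρ : ℕ → X} (h : ∀ φ ∈ thB, FSat dom r φ ρ) : ThB dom r := by
  simp [thB, FSat, FSat_imp, FSat_ex, FO.pNil, FO.pZ, FO.pS, FO.pC,
    FO.pT, FO.pN] at h
  obtain ⟨h1, h2, h3, h4, h5, h6, h7, h8, h9, h10, h11⟩ := h
  exact ⟨h1, h2, h3, h4, h5, h6, h7, h8, h9, h10, h11⟩

theorem Rep.exists_succ (B : ThB dom r) {n : ℕ} {l : List ℕ} {x : X}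
    (h : Rep dom r (n :: l) x) : ∃ x', r 5 x' x x ∧ Rep dom r ((n + 1) :: l) x' := by
  have : ∃ x', dom x' ∧ r 5 x' x x := by
    cases h with
    | zero _ _ y hx hr hy => exact B.succ1 x hx y hy.inD hr
    | succ _ _ _ y hx hr hy => exact B.succ2 x hx y hy.inD hr
  obtain ⟨x', h1, h2⟩ := this
  exact ⟨x', h2, .succ _ _ _ _ h1 h2 h⟩

theorem Rep.exists_zero (B : ThB dom r) {l : List ℕ} {x : X}
    (h : Rep dom r l x) : ∃ x', r 3 x' x x ∧ Rep dom r (0 :: l) x' := by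
  obtain ⟨x', h1, h2⟩ := B.zero x h.inD
  exact ⟨x', h2, .zero _ _ _ h1 h2 h⟩

theorem Rep.exists_cons (B : ThB dom r) {l l' : List ℕ} {a b : X}
    (ha : Rep dom r l a) (hb : Rep dom r l' b) :
    ∃ c, r 7 a b c ∧ Rep dom r (l.headI :: l') c := by
  induction ha with
  | nil a h1 h2 =>
    obtain ⟨c, h3, h4⟩ := hb.exists_zero B
    exact ⟨c, B.c1 a h1 b hb.inD c h4.inD h2 h3, h4⟩
  | zero l a d h1 h2 hd ih =>
    obtain ⟨c, h3, h4⟩ := hb.exists_zero B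
    exact ⟨c, B.c2 a h1 b hb.inD c h4.inD d hd.inD h2 h3, h4⟩
  | succ n l a' a h1 h2 ha ih =>
    obtain ⟨c, h3, h4⟩ := ih
    obtain ⟨c', h5, h6⟩ := h4.exists_succ B
    exact ⟨c', B.c3 a' h1 a ha.inD b hb.inD c h4.inD c' h6.inD h2 h3 h5, h6⟩

theorem Rep.exists_tail (B : ThB dom r) {l : List ℕ} {a : X}
    (ha : Rep dom r l a) : ∃ c, r 9 a c c ∧ Rep dom r l.tail c := by
  induction ha with
  | nil a h1 h2 => exact ⟨a, B.t1 a h1 h2, .nil a h1 h2⟩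
  | zero l a d h1 h2 hd ih => exact ⟨d, B.t2 a h1 d hd.inD h2, hd⟩
  | succ n l a' a h1 h2 ha ih =>
    obtain ⟨c, h3, h4⟩ := ih
    exact ⟨c, B.t3 a' h1 a ha.inD c h4.inD h2 h3, h4⟩

theorem sound_code (B : ThB dom r) {ρ : ℕ → X} (c : Code) (h : ∀ φ ∈ thC c, FSat dom r φ ρ) :
    ∀ v w x, w ∈ c.eval v → Rep dom r v x →
      ∃ y, r (11 + 2 * enc c) x y y ∧ Rep dom r w y := by
  induction c with
  | zero' =>
    simp [thC, FSat, FSat_imp, FO.pZ, FO.pE] at h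
    intro v w x hw hx
    rw [mem_zero'] at hw
    subst hw
    obtain ⟨y, h1, h2⟩ := hx.exists_zero B
    exact ⟨y, h x hx.inD y h2.inD h1, h2⟩
  | succ =>
    simp [thC, FSat, FSat_imp, FO.pNil, FO.pC, FO.pS, FO.pE] at h
    intro v w x hw hx
    rw [mem_succ] at hw
    subst hw
    obtain ⟨n, n1, n2⟩ := B.nil
    obtain ⟨c, h1, h2⟩ := hx.exists_cons B (Rep.nil n n1 n2)
    obtain ⟨d, h3, h4⟩ := h2.exists_succ B
    exact ⟨d, h x hx.inD n n1 c h2.inD d h4.inD n2 h1 h3, h4⟩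
  | tail =>
    simp [thC, FSat, FSat_imp, FO.pT, FO.pE] at h
    intro v w x hw hx
    rw [mem_tail] at hw
    subst hw
    obtain ⟨y, h1, h2⟩ := hx.exists_tail B
    exact ⟨y, h x hx.inD y h2.inD h1, h2⟩
  | cons f g ih1 ih2 =>
    simp only [thC, List.forall_mem_cons, List.forall_mem_append] at h
    obtain ⟨h, hf, hg⟩ := h
    simp [FSat, FSat_imp, FO.pC, FO.pE] at h
    intro v w x hw hx
    rw [mem_cons] at hw
    obtain ⟨a, ha, b, hb, rfl⟩ := hw
    obtain ⟨y, y1, y2⟩ := ih1 hf v a x ha hx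
    obtain ⟨z, z1, z2⟩ := ih2 hg v b x hb hx
    obtain ⟨c, c1, c2⟩ := y2.exists_cons B z2
    exact ⟨c, h x hx.inD y y2.inD z z2.inD c c2.inD y1 z1 c1, c2⟩
  | comp f g ih1 ih2 =>
    simp only [thC, List.forall_mem_cons, List.forall_mem_append] at h
    obtain ⟨h, hf, hg⟩ := h
    simp [FSat, FSat_imp, FO.pE] at h
    intro v w x hw hx
    rw [mem_comp] at hw
    obtain ⟨a, ha, hb⟩ := hw
    obtain ⟨y, y1, y2⟩ := ih2 hg v a x ha hx
    obtain ⟨z, z1, z2⟩ := ih1 hf a w y hb y2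
    exact ⟨z, h x hx.inD y y2.inD z z2.inD y1 z1, z2⟩
  | case f g ih1 ih2 =>
    simp only [thC, List.forall_mem_cons, List.forall_mem_append] at h
    obtain ⟨h1, h2, h3, hf, hg⟩ := h
    simp [FSat, FSat_imp, FO.pE, FO.pNil, FO.pZ, FO.pS] at h1 h2 h3
    intro v w x hw hx
    cases hx with
    | nil _ q1 q2 =>
      rw [mem_case_nil] at hw
      obtain ⟨y, y1, y2⟩ := ih1 hf _ _ x hw (.nil x q1 q2)
      exact ⟨y, h1 x q1 y y2.inD q2 y1, y2⟩
    | zero l _ z q1 q2 hz =>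
      rw [mem_case_zero] at hw
      obtain ⟨y, y1, y2⟩ := ih1 hf _ _ z hw hz
      exact ⟨y, h2 x q1 z hz.inD y y2.inD q2 y1, y2⟩
    | succ n l _ z q1 q2 hz =>
      rw [mem_case_succ] at hw
      obtain ⟨y, y1, y2⟩ := ih2 hg _ _ z hw hz
      exact ⟨y, h3 x q1 z hz.inD y y2.inD q2 y1, y2⟩
  | fix f ih =>
    simp only [thC, List.forall_mem_cons] at h
    obtain ⟨h1, h2, h3, hf⟩ := h
    simp [FSat, FSat_imp, FO.pE, FO.pNil, FO.pZ, FO.pS, FO.pT] at h1 h2 h3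
    intro v w x hw hx
    refine fix_ind f w (fun v => ∀ x, Rep dom r v x →
      ∃ y, r (11 + 2 * enc (.fix f)) x y y ∧ Rep dom r w y) ?_ ?_ v hw x hx
    · rintro v u hu h0 rfl x hx
      obtain ⟨y, y1, y2⟩ := ih hf v u x hu hx
      cases y2 with
      | nil _ q1 q2 => exact ⟨y, h1 x hx.inD y q1 y1 q2, .nil y q1 q2⟩
      | zero l _ z q1 q2 hz => exact ⟨z, h2 x hx.inD y q1 z hz.inD y1 q2, hz⟩
      | succ n l _ z q1 q2 hz => simp at h0
    · rintro v u hu h0 ihu x hx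
      obtain ⟨y, y1, y2⟩ := ih hf v u x hu hx
      obtain ⟨t, t1, t2⟩ := y2.exists_tail B
      obtain ⟨o, o1, o2⟩ := ihu t t2
      cases y2 with
      | nil _ q1 q2 => simp at h0
      | zero l _ z q1 q2 hz => simp at h0
      | succ n l _ z q1 q2 hz =>
        exact ⟨o, h3 x hx.inD y q1 z hz.inD t t2.inD o o2.inD y1 q2 t1 o1, o2⟩

theorem sound_num (B : ThB dom r) {ρ : ℕ → X} (k : ℕ)
    (h : ∀ j < k, FSat dom r (numAx j) ρ) :
    ∃ x, r (2 * k) x x x ∧ Rep dom r [k] x := by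
  induction k with
  | zero =>
    obtain ⟨n, n1, n2⟩ := B.nil
    obtain ⟨x, h1, h2⟩ := (Rep.nil n n1 n2).exists_zero B
    exact ⟨x, B.n0 n n1 x h2.inD n2 h1, h2⟩
  | succ k ih =>
    obtain ⟨x, h1, h2⟩ := ih (fun j hj => h j (by omega))
    have := h k (by omega)
    simp [numAx, FSat, FSat_imp, FO.pN, FO.pS] at this
    obtain ⟨y, h3, h4⟩ := h2.exists_succ B
    exact ⟨y, this x h2.inD y h4.inD h1 h3, h4⟩

theorem sound_all {ρ : ℕ → X} (c : Code) (k : ℕ) (h0 : ∀ φ ∈ thB, FSat dom r φ ρ)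
    (h1 : ∀ φ ∈ thC c, FSat dom r φ ρ) (h2 : ∀ j < k, FSat dom r (numAx j) ρ)
    (h3 : FSat dom r (goalAx c k) ρ) : ¬ (c.eval [k]).Dom := by
  intro hd
  obtain ⟨w, hw⟩ := Part.dom_iff_mem.1 hd
  have B := ThB_of h0
  obtain ⟨x, x1, x2⟩ := sound_num B k h2
  obtain ⟨y, y1, y2⟩ := sound_code B c h1 [k] w x hw x2
  simp [goalAx, FSat, FSat_imp, FO.pN, FO.pE] at h3
  exact h3 x x2.inD y y2.inD x1 y1

end sound

/-! ### The reduction -/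

def fixedF (c : Code) : Form :=
  (baseF 5).and ((conj (thB.map tr)).and (conj ((thC c).map tr)))

def numsF : ℕ → Form
  | 0 => top
  | k + 1 => (tr (numAx k)).and (numsF k)

def redF (c : Code) (k : ℕ) : Form := (fixedF c).and ((numsF k).and (tr (goalAx c k)))

theorem sat_numsF {W : Type} (M : SLLModel W) (w : W) (k : ℕ) :
    Sat M (numsF k) w [] ↔ ∀ j < k, Sat M (tr (numAx j)) w [] := by
  induction k with
  | zero => simp [numsF, sat_top]
  | succ k ih =>
    simp only [numsF, Sat, ih]
    constructor
    · rintro ⟨h1, h2⟩ j hj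
      rcases Nat.lt_succ_iff_lt_or_eq.1 hj with h | rfl
      · exact h2 j h
      · exact h1
    · intro h
      exact ⟨h k (by omega), fun j hj => h j (by omega)⟩

theorem redF_sat (c : Code) (k : ℕ) :
    (∃ (W : Type) (M : SLLModel W) (w : W), Sat M (redF c k) w []) ↔ ¬ (c.eval [k]).Dom := by
  have hK : 0 < 5 := by omega
  constructor
  · rintro ⟨W, M, w, h⟩
    simp only [redF, fixedF, Sat, baseF_iff, sat_conj, List.forall_mem_map, sat_numsF] at h
    obtain ⟨⟨B, h1, h2⟩, h3, h4⟩ := h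
    refine sound_all (dom := dm M w) (r := rl M w) (ρ := fun _ => w) c k ?_ ?_ ?_ ?_
    · exact fun φ hφ => (tr_iff_closed hK B φ (wf_thB φ hφ)).1 (h1 φ hφ)
    · exact fun φ hφ => (tr_iff_closed hK B φ (wf_thC c φ hφ)).1 (h2 φ hφ)
    · exact fun j hj => (tr_iff_closed hK B _ (wf_numAx j)).1 (h3 j hj)
    · exact (tr_iff_closed hK B _ (wf_goalAx c k)).1 h4
  · intro h
    refine ⟨Wd (List ℕ), stdM rS, .root, ?_⟩
    simp only [redF, fixedF, Sat, baseF_iff, sat_conj, List.forall_mem_map, sat_numsF]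
    refine ⟨⟨stdM_base rS 5, ?_, ?_⟩, ?_, ?_⟩
    · exact fun φ hφ => (stdM_tr rS hK φ (wf_thB φ hφ) (fun _ => [])).2 (std_thB _ φ hφ)
    · exact fun φ hφ => (stdM_tr rS hK φ (wf_thC c φ hφ) (fun _ => [])).2 (std_thC _ c φ hφ)
    · exact fun j _ => (stdM_tr rS hK _ (wf_numAx j) (fun _ => [])).2 (std_numAx _ j)
    · exact (stdM_tr rS hK _ (wf_goalAx c k) (fun _ => [])).2 (std_goalAx _ c k h)

/-! membership in the fragment -/

theorem frag_top : InDiaRem1Frag top := by simp [top, bot, InDiaRem1Frag]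

theorem frag_lo (n : ℕ) : InDiaRem1Frag (lo n) := by
  induction n with
  | zero => exact frag_top
  | succ n ih => exact ⟨ih, trivial⟩

theorem frag_T (n : ℕ) : InDiaRem1Frag (T n) := ⟨frag_lo n, trivial⟩

theorem frag_imp (φ ψ : Form) (h1 : InDiaRem1Frag φ) (h2 : InDiaRem1Frag ψ) :
    InDiaRem1Frag (imp φ ψ) := ⟨h1, h2⟩

theorem frag_box (φ : Form) (h : InDiaRem1Frag φ) : InDiaRem1Frag (box φ) := h

theorem frag_mark (i : ℕ) (φ : Form) (h : InDiaRem1Frag φ) : InDiaRem1Frag (mark i φ) :=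
  ⟨frag_T _, frag_T _, frag_T _, frag_T _, h⟩

theorem frag_posF (t a : ℕ) : InDiaRem1Frag (posF t a) := ⟨frag_T _, frag_T _, frag_T _⟩

theorem frag_tr (φ : FO) : InDiaRem1Frag (tr φ) := by
  induction φ with
  | rel P a b c => exact ⟨frag_T _, frag_posF _ _, frag_posF _ _, frag_posF _ _⟩
  | neg φ ih => exact ih
  | and φ ψ ih1 ih2 => exact ⟨ih1, ih2⟩
  | all i φ ih =>
    exact frag_box _ (frag_imp _ _ (frag_T _) (frag_box _ (frag_imp _ _ (frag_T _)
      (frag_mark _ _ ih))))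

theorem frag_conj (l : List Form) (h : ∀ φ ∈ l, InDiaRem1Frag φ) : InDiaRem1Frag (conj l) := by
  induction l with
  | nil => exact frag_top
  | cons a l ih =>
    exact ⟨h a (by simp), ih fun φ hφ => h φ (by simp [hφ])⟩

theorem frag_baseF (K : ℕ) : InDiaRem1Frag (baseF K) := by
  refine ⟨frag_T _, frag_conj _ ?_, frag_conj _ ?_, frag_conj _ ?_⟩
  · simp only [List.forall_mem_map]
    intro i _
    refine frag_conj _ ?_
    simp only [List.forall_mem_map]
    intro j _
    exact frag_box _ (frag_imp _ _ (frag_T _) (frag_box _ (frag_imp _ _ (frag_T _)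
      (frag_mark _ _ frag_top))))
  · simp only [List.forall_mem_map]
    intro i _
    refine frag_conj _ ?_
    simp only [List.forall_mem_map]
    intro j _
    unfold ax2
    split_ifs
    · exact frag_top
    · exact frag_box _ (frag_imp _ _ (frag_T _) (frag_box _ (frag_imp _ _ (frag_T _)
        (frag_mark _ _ ⟨frag_T _, frag_T _, frag_T _⟩))))
  · simp only [List.forall_mem_map]
    intro i _
    exact frag_box _ (frag_box _ (frag_box _ (frag_imp _ _ (frag_T _) (frag_T (tM i)))))

theorem frag_redF (c : Code) (k : ℕ) : InDiaRem1Frag (redF c k) := by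
  refine ⟨⟨frag_baseF 5, frag_conj _ ?_, frag_conj _ ?_⟩, ?_, frag_tr _⟩
  · simp only [List.forall_mem_map]
    exact fun φ _ => frag_tr φ
  · simp only [List.forall_mem_map]
    exact fun φ _ => frag_tr φ
  · induction k with
    | zero => exact frag_top
    | succ k ih => exact ⟨frag_tr _, ih⟩

/-! computability of the reduction -/

theorem encode_inj : ∀ φ ψ : Form, φ.encode = ψ.encode → φ = ψ := by
  intro φ
  induction φ with
  | atom n => intro d h; cases d <;> simp [Form.encode, Nat.pair_eq_pair] at h ⊢; exact h
  | and f g ih1 ih2 =>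
    intro d h; cases d <;> simp [Form.encode, Nat.pair_eq_pair] at h ⊢
    exact ⟨ih1 _ h.1, ih2 _ h.2⟩
  | neg f ih =>
    intro d h; cases d <;> simp [Form.encode, Nat.pair_eq_pair] at h ⊢
    exact ih _ h
  | dia f ih =>
    intro d h; cases d <;> simp [Form.encode, Nat.pair_eq_pair] at h ⊢
    exact ih _ h
  | rem1 f ih =>
    intro d h; cases d <;> simp [Form.encode, Nat.pair_eq_pair] at h ⊢
    exact ih _ h
  | rem2 f ih =>
    intro d h; cases d <;> simp [Form.encode, Nat.pair_eq_pair] at h ⊢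
    exact ih _ h
  | add f ih =>
    intro d h; cases d <;> simp [Form.encode, Nat.pair_eq_pair] at h ⊢
    exact ih _ h

/-- a primitive recursive family of formulas -/
def PF (f : ℕ → Form) : Prop := Primrec fun k => (f k).encode

theorem PF.const (φ : Form) : PF fun _ => φ := Primrec.const _

theorem PF.neg {f : ℕ → Form} (h : PF f) : PF fun k => .neg (f k) :=
  Primrec₂.natPair.comp (Primrec.const 1) h

theorem PF.dia {f : ℕ → Form} (h : PF f) : PF fun k => .dia (f k) :=
  Primrec₂.natPair.comp (Primrec.const 3) h

theorem PF.rem1 {f : ℕ → Form} (h : PF f) : PF fun k => .rem1 (f k) :=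
  Primrec₂.natPair.comp (Primrec.const 4) h

theorem PF.and {f g : ℕ → Form} (h : PF f) (h' : PF g) : PF fun k => .and (f k) (g k) :=
  Primrec₂.natPair.comp (Primrec.const 2) (Primrec₂.natPair.comp h h')

theorem PF.atom {f : ℕ → ℕ} (h : Primrec f) : PF fun k => .atom (f k) :=
  Primrec₂.natPair.comp (Primrec.const 0) h

theorem PF.imp {f g : ℕ → Form} (h : PF f) (h' : PF g) : PF fun k => Form.imp (f k) (g k) :=
  (h.neg.neg.and h'.neg).neg

theorem PF.box {f : ℕ → Form} (h : PF f) : PF fun k => Form.box (f k) := h.neg.dia.neg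

theorem PF.rec {f : ℕ → Form} {g : ℕ → Form} (h : PF g)
    (hs : ∀ k, f (k + 1) = (f k).and (g k)) : PF f := by
  have : Primrec fun k => Nat.rec (motive := fun _ => ℕ) (f 0).encode
      (fun j e => Nat.pair 2 (Nat.pair e (g j).encode)) k :=
    Primrec.nat_rec₁ _ (Primrec₂.natPair.comp (Primrec.const 2)
      (Primrec₂.natPair.comp Primrec.snd (Primrec.comp (f := fun k => (g k).encode) h Primrec.fst)))
  refine this.of_eq fun k => ?_
  induction k with
  | zero => rfl
  | succ k ih => rw [hs]; simp only [Form.encode]; rw [← ih]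

theorem PF.rec' {f : ℕ → Form} {g : ℕ → Form} (h : PF g)
    (hs : ∀ k, f (k + 1) = (g k).and (f k)) : PF f := by
  have : Primrec fun k => Nat.rec (motive := fun _ => ℕ) (f 0).encode
      (fun j e => Nat.pair 2 (Nat.pair (g j).encode e)) k :=
    Primrec.nat_rec₁ _ (Primrec₂.natPair.comp (Primrec.const 2)
      (Primrec₂.natPair.comp (Primrec.comp (f := fun k => (g k).encode) h Primrec.fst) Primrec.snd))
  refine this.of_eq fun k => ?_
  induction k with
  | zero => rfl
  | succ k ih => rw [hs]; simp only [Form.encode]; rw [← ih]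

theorem PF.lo : PF lo := PF.rec (PF.atom Primrec.id).neg fun _ => rfl

theorem PF.T {f : ℕ → ℕ} (h : Primrec f) : PF fun k => T (f k) :=
  PF.and (Primrec.comp (f := fun k => (SLLUndec.lo k).encode) PF.lo h) (PF.atom h)

theorem PF.rel {f : ℕ → ℕ} (h : Primrec f) (a b c : ℕ) : PF fun k => tr (.rel (f k) a b c) :=
  ((PF.T (f := fun k => tF (f k)) (Primrec.nat_add.comp (Primrec.const 7)
    (Primrec.nat_mul.comp (Primrec.const 3) h))).and (PF.const _)).dia

theorem PF.all {f : ℕ → FO} (h : PF fun k => tr (f k)) (i : ℕ) : PF fun k => tr (.all i (f k)) :=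
  ((PF.const _).imp ((PF.const _).imp
    ((PF.const _).and (PF.rem1 ((PF.const _).and ((PF.const _).and
      (PF.rem1 ((PF.const _).and h)))))).dia).box).box

theorem PF.fimp {f g : ℕ → FO} (h : PF fun k => tr (f k)) (h' : PF fun k => tr (g k)) :
    PF fun k => tr (.imp (f k) (g k)) :=
  (h.and h'.neg).neg

theorem PF.numAx : PF fun k => tr (numAx k) := by
  have h1 : Primrec fun k : ℕ => 2 * k := Primrec.nat_mul.comp (Primrec.const 2) Primrec.id
  have h2 : Primrec fun k : ℕ => 2 * (k + 1) :=
    Primrec.nat_mul.comp (Primrec.const 2) Primrec.succ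
  exact PF.all (PF.all (PF.fimp (PF.rel h1 0 0 0) (PF.fimp (PF.const _) (PF.rel h2 1 1 1))) 1) 0

theorem PF.goalAx (c : Code) : PF fun k => tr (goalAx c k) := by
  have h1 : Primrec fun k : ℕ => 2 * k := Primrec.nat_mul.comp (Primrec.const 2) Primrec.id
  exact PF.all (PF.all (PF.fimp (PF.rel h1 0 0 0) (PF.const (tr (.neg (.pE c 0 1))))) 1) 0

theorem PF.redF (c : Code) : PF (redF c) :=
  (PF.const _).and ((PF.rec' PF.numAx fun _ => rfl).and (PF.goalAx c))

theorem exists_univ : ∃ c : Code, ∀ k : ℕ, (c.eval [k]).Dom ↔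
    ((Denumerable.ofNat Nat.Partrec.Code k).eval 0).Dom := by
  have hp : Partrec fun k : ℕ => (Denumerable.ofNat Nat.Partrec.Code k).eval 0 :=
    Nat.Partrec.Code.eval_part.comp (Computable.ofNat _) (Computable.const 0)
  obtain ⟨c, hc⟩ := Code.exists_code (Nat.Partrec'.part_iff₁.2 hp)
  refine ⟨c, fun k => ?_⟩
  have := hc (k ::ᵥ List.Vector.nil)
  have h2 : (k ::ᵥ List.Vector.nil : List.Vector ℕ 1).1 = [k] := rfl
  rw [h2] at this
  rw [this]
  simp

end SLLUndec

/-- The satisfiability problem for L_♦⟨-⟩₁ is undecidable: the set of (codes of)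
fragment formulas satisfiable w.r.t. 𝔐• is not a computable predicate. -/
theorem diaRem1Frag_sat_undecidable :
    ¬ ComputablePred (fun n : ℕ => ∃ φ : Form, Form.encode φ = n ∧ InDiaRem1Frag φ ∧
      ∃ (W : Type) (M : SLLModel W) (w : W), Sat M φ w []) := by

  intro hc
  obtain ⟨c, hc0⟩ := SLLUndec.exists_univ
  have h1 : ComputablePred fun d : Nat.Partrec.Code => ¬ (d.eval 0).Dom := by
    refine ComputablePred.computable_of_manyOneReducible
      ⟨fun d => (SLLUndec.redF c (Encodable.encode d)).encode,
        (SLLUndec.PF.redF c).to_comp.comp Computable.encode, fun d => ?_⟩ hc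
    have key := SLLUndec.redF_sat c (Encodable.encode d)
    rw [hc0, Denumerable.ofNat_encode] at key
    refine Iff.trans key.symm ?_
    constructor
    · intro h
      exact ⟨_, rfl, SLLUndec.frag_redF _ _, h⟩
    · rintro ⟨φ, h, _, h'⟩
      rw [SLLUndec.encode_inj _ _ h] at h'
      exact h'
  refine ComputablePred.halting_problem 0 ?_
  exact h1.not.of_eq fun d => not_not
end
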